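/- Let K be a scattered, locally compact Hausdorff topological space, and for each bounded linear operator T on C₀(K) define μ(T) = 0 if T is compact, and otherwise μ(T) = sup{ 1/(‖U‖·‖V‖) : U : C₀(K) → c₀ and V : c₀ → C₀(K) are bounded linear operators such that I_{c₀} − U∘T∘V is compact }. Then: (i) for every non-compact T the set in the supremum is nonempty, and μ(T) > 0; (ii) μ(T) ≤ ‖T‖ₑ for every T; (iii) μ(T) = μ(T') whenever T − T' is compact; (iv) μ(λT) = |λ|·μ(T) for every scalar λ; (v) μ(T₁ + T₂) ≤ μ(T₁) + μ(T₂); and (vi) μ(T₂∘T₁) ≤ μ(T₂)·μ(T₁). In particular, μ induces an algebra norm on the Calkin algebra B(C₀(K))/K(C₀(K)) dominated by the essential norm. -/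

import Mathlib

open scoped ENNReal ZeroAtInfty

namespace ZeroAtInftyCalkin

open Filter Topology Set

section Basic

variable {𝕜 : Type*} [RCLike 𝕜] {X : Type*} [TopologicalSpace X]

lemma norm_apply_le (h : C₀(X, 𝕜)) (x : X) : ‖h x‖ ≤ ‖h‖ :=
  h.toBCF.norm_coe_le_norm x

lemma norm_le_of_forall {h : C₀(X, 𝕜)} {C : ℝ} (hC : 0 ≤ C) (H : ∀ x, ‖h x‖ ≤ C) : ‖h‖ ≤ C :=
  (BoundedContinuousFunction.norm_le (f := h.toBCF) hC).2 H

variable (𝕜) in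
/-- Evaluation at a point, as a bounded linear functional on `C₀(X, 𝕜)`. -/
noncomputable def evalCLM (x : X) : C₀(X, 𝕜) →L[𝕜] 𝕜 :=
  LinearMap.mkContinuous
    { toFun := fun h => h x
      map_add' := fun _ _ => rfl
      map_smul' := fun _ _ => rfl } 1 (fun h => by simpa using norm_apply_le h x)

@[simp] lemma evalCLM_apply (x : X) (h : C₀(X, 𝕜)) : evalCLM 𝕜 x h = h x := rfl

lemma norm_evalCLM_le (x : X) : ‖evalCLM 𝕜 x‖ ≤ 1 :=
  LinearMap.mkContinuous_norm_le _ zero_le_one _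

lemma sum_apply {ι : Type*} (s : Finset ι) (v : ι → C₀(X, 𝕜)) (x : X) :
    (∑ i ∈ s, v i) x = ∑ i ∈ s, v i x :=
  map_sum (evalCLM 𝕜 x) v s

/-- A continuous compactly supported real function, as an element of `C₀(X, 𝕜)`. -/
noncomputable def ofCompactSupport (f : C(X, ℝ)) (hf : HasCompactSupport f) : C₀(X, 𝕜) where
  toFun x := (f x : 𝕜)
  continuous_toFun := RCLike.continuous_ofReal.comp f.continuous
  zero_at_infty' := by
    have h : HasCompactSupport (fun x => (f x : 𝕜)) := hf.comp_left (g := RCLike.ofReal) (by simp)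
    exact h.is_zero_at_infty

@[simp] lemma ofCompactSupport_apply (f : C(X, ℝ)) (hf : HasCompactSupport f) (x : X) :
    (ofCompactSupport f hf : C₀(X, 𝕜)) x = (f x : 𝕜) := rfl

lemma tendsto_zeroAtInfty_nat (a : C₀(ℕ, 𝕜)) : Tendsto a atTop (𝓝 0) := by
  have := a.zero_at_infty'
  rwa [cocompact_eq_cofinite, Nat.cofinite_eq_atTop] at this

variable (𝕜) in
/-- The unit vector basis of `c₀ = C₀(ℕ, 𝕜)`. -/
noncomputable def unitVec (n : ℕ) : C₀(ℕ, 𝕜) where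
  toFun := Pi.single n 1
  continuous_toFun := continuous_of_discreteTopology
  zero_at_infty' := by
    rw [cocompact_eq_cofinite, Nat.cofinite_eq_atTop]
    refine tendsto_const_nhds.congr' ?_
    filter_upwards [eventually_gt_atTop n] with m hm
    simp [hm.ne']

lemma unitVec_apply (n m : ℕ) : unitVec 𝕜 n m = if m = n then 1 else 0 := by
  change (Pi.single n 1 : ℕ → 𝕜) m = _
  simp [Pi.single_apply]

lemma norm_unitVec_le (n : ℕ) : ‖unitVec 𝕜 n‖ ≤ 1 := by
  refine norm_le_of_forall zero_le_one fun m => ?_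
  rw [unitVec_apply]; split_ifs <;> simp

lemma hasSum_unitVec (a : C₀(ℕ, 𝕜)) : HasSum (fun n => a n • unitVec 𝕜 n) a := by
  rw [HasSum, SummationFilter.unconditional_filter, Metric.tendsto_atTop]
  intro ε hε
  obtain ⟨N, hN⟩ := Metric.tendsto_atTop.1 (tendsto_zeroAtInfty_nat a) (ε / 2) (half_pos hε)
  refine ⟨Finset.range N, fun F hF => ?_⟩
  rw [dist_eq_norm]
  refine lt_of_le_of_lt (norm_le_of_forall (half_pos hε).le fun m => ?_) (half_lt_self hε)
  rw [ZeroAtInftyContinuousMap.sub_apply, sum_apply]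
  have h1 : ∑ i ∈ F, (a i • unitVec 𝕜 i) m = if m ∈ F then a m else 0 := by
    simp [unitVec_apply]
  rw [h1]
  split_ifs with hm
  · simpa using (half_pos hε).le
  · have : N ≤ m := by
      by_contra hlt
      exact hm (hF (Finset.mem_range.2 (not_le.1 hlt)))
    simpa using (hN m this).le

/-- A disjointly supported sequence in the unit ball of `C₀(X, 𝕜)` is the image of the unit
vector basis under a contraction from `c₀`. -/
lemma exists_clm_of_disjoint (v : ℕ → C₀(X, 𝕜)) (hv : ∀ n, ‖v n‖ ≤ 1)
    (hd : ∀ i j, i ≠ j → ∀ x, v i x = 0 ∨ v j x = 0) :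
    ∃ V : C₀(ℕ, 𝕜) →L[𝕜] C₀(X, 𝕜), ‖V‖ ≤ 1 ∧ ∀ n, V (unitVec 𝕜 n) = v n := by
  have key : ∀ (a : ℕ → 𝕜) (C : ℝ) (F : Finset ℕ), 0 ≤ C → (∀ n ∈ F, ‖a n‖ ≤ C) →
      ‖∑ n ∈ F, a n • v n‖ ≤ C := by
    intro a C F hC ha
    refine norm_le_of_forall hC fun x => ?_
    rw [sum_apply]
    by_cases hx : ∃ i ∈ F, v i x ≠ 0
    · obtain ⟨i, hi, hix⟩ := hx
      rw [Finset.sum_eq_single_of_mem i hi]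
      · rw [ZeroAtInftyContinuousMap.smul_apply, norm_smul]
        calc ‖a i‖ * ‖v i x‖ ≤ C * 1 :=
              mul_le_mul (ha i hi) ((norm_apply_le _ x).trans (hv i)) (norm_nonneg _) hC
          _ = C := mul_one C
      · intro j _ hji
        rw [ZeroAtInftyContinuousMap.smul_apply, (hd i j hji.symm x).resolve_left hix, smul_zero]
    · push Not at hx
      rw [Finset.sum_eq_zero]
      · simpa using hC
      · intro i hi
        rw [ZeroAtInftyContinuousMap.smul_apply, hx i hi, smul_zero]
  have hs : ∀ a : C₀(ℕ, 𝕜), Summable fun n => a n • v n := by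
    intro a
    rw [summable_iff_vanishing_norm]
    intro ε hε
    obtain ⟨N, hN⟩ := Metric.tendsto_atTop.1 (tendsto_zeroAtInfty_nat a) (ε / 2) (half_pos hε)
    refine ⟨Finset.range N, fun F hF => ?_⟩
    refine lt_of_le_of_lt (key a (ε / 2) F (half_pos hε).le fun n hn => ?_) (half_lt_self hε)
    have : N ≤ n := by
      by_contra hlt
      exact Finset.disjoint_left.1 hF hn (Finset.mem_range.2 (not_le.1 hlt))
    simpa using (hN n this).le
  refine ⟨LinearMap.mkContinuous
    { toFun := fun a => ∑' n, a n • v n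
      map_add' := fun a b => ?_
      map_smul' := fun c a => ?_ } 1 fun a => ?_, LinearMap.mkContinuous_norm_le _ zero_le_one _,
    fun n => ?_⟩
  · rw [← (hs a).tsum_add (hs b)]
    exact tsum_congr fun n => add_smul (a n) (b n) (v n)
  · rw [RingHom.id_apply, ← (hs a).tsum_const_smul c]
    simp [mul_smul]
  · rw [one_mul]
    exact le_of_tendsto (hs a).hasSum.norm
      (Eventually.of_forall fun F => key a _ F (norm_nonneg a) fun n _ => norm_apply_le a n)
  · change ∑' m, unitVec 𝕜 n m • v m = v n
    rw [tsum_eq_single n]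
    · simp [unitVec_apply]
    · intro m hm
      simp [unitVec_apply, hm]

/-- A bounded pointwise null sequence of functionals defines an operator into `c₀`. -/
lemma exists_clm_of_tendsto {E : Type*} [NormedAddCommGroup E] [NormedSpace 𝕜 E]
    (u : ℕ → E →L[𝕜] 𝕜) {C : ℝ} (hC : 0 ≤ C) (hu : ∀ n, ‖u n‖ ≤ C)
    (h0 : ∀ x, Tendsto (fun n => u n x) atTop (𝓝 0)) :
    ∃ U : E →L[𝕜] C₀(ℕ, 𝕜), ‖U‖ ≤ C ∧ ∀ x n, U x n = u n x := by
  refine ⟨LinearMap.mkContinuous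
    { toFun := fun x =>
        { toFun := fun n => u n x
          continuous_toFun := continuous_of_discreteTopology
          zero_at_infty' := by
            rw [cocompact_eq_cofinite, Nat.cofinite_eq_atTop]; exact h0 x }
      map_add' := fun x y => ?_
      map_smul' := fun c x => ?_ } C fun x => ?_, LinearMap.mkContinuous_norm_le _ hC _,
    fun x n => rfl⟩
  · ext n; exact map_add (u n) x y
  · ext n; exact map_smul (u n) c x
  · exact norm_le_of_forall (by positivity) fun n => (u n).le_of_opNorm_le (hu n) x

/-- Compact operators on `c₀` map the unit vector basis to a null sequence. -/
lemma tendsto_unitVec_of_isCompactOperator {E : Type*} [NormedAddCommGroup E] [NormedSpace 𝕜 E]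
    {S : C₀(ℕ, 𝕜) →L[𝕜] E} (hS : IsCompactOperator S) :
    Tendsto (fun n => S (unitVec 𝕜 n)) atTop (𝓝 0) := by
  let _ : NormedSpace ℝ E := NormedSpace.restrictScalars ℝ 𝕜 E
  obtain ⟨Q, hQ, hSQ⟩ := hS.image_closedBall_subset_compact (f := (S : C₀(ℕ, 𝕜) →ₗ[𝕜] E)) 1
  refine tendsto_of_subseq_tendsto fun ns hns => ?_
  obtain ⟨φ, hφ, hφm⟩ := strictMono_subseq_of_tendsto_atTop hns
  obtain ⟨y, -, ψ, hψ, hy⟩ := hQ.tendsto_subseq (x := fun n => S (unitVec 𝕜 (ns (φ n))))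
    (fun n => hSQ ⟨_, by simpa using norm_unitVec_le _, rfl⟩)
  refine ⟨φ ∘ ψ, ?_⟩
  have hm : StrictMono (ns ∘ φ ∘ ψ) := hφm.comp hψ
  suffices y = 0 by rw [this] at hy; exact hy
  have hces := hy.cesaro_smul
  refine tendsto_nhds_unique hces ?_
  refine squeeze_zero_norm (a := fun n : ℕ => (n : ℝ)⁻¹ * ‖S‖) (fun n => ?_) ?_
  · rw [norm_smul, norm_inv, RCLike.norm_natCast]
    gcongr
    simp only [Function.comp_apply]
    rw [← map_sum]
    refine (S.le_opNorm _).trans (mul_le_of_le_one_right (norm_nonneg _) ?_)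
    refine norm_le_of_forall zero_le_one fun m => ?_
    rw [sum_apply]
    by_cases hx : ∃ i ∈ Finset.range n, unitVec 𝕜 (ns (φ (ψ i))) m ≠ 0
    · obtain ⟨i, hi, hix⟩ := hx
      rw [Finset.sum_eq_single_of_mem i hi]
      · exact (norm_apply_le _ _).trans (norm_unitVec_le _)
      · intro j _ hji
        have h1 : m = ns (φ (ψ i)) := by
          by_contra hne
          simp [unitVec_apply, hne] at hix
        rw [unitVec_apply, if_neg]
        rw [h1]
        exact fun h => hji (hm.injective h.symm)
    · push Not at hx
      rw [Finset.sum_eq_zero hx]; simp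
  · simpa using (tendsto_inv_atTop_nhds_zero_nat (𝕜 := ℝ)).mul_const ‖S‖

lemma tendsto_functional_unitVec (g : C₀(ℕ, 𝕜) →L[𝕜] 𝕜) :
    Tendsto (fun n => g (unitVec 𝕜 n)) atTop (𝓝 0) :=
  tendsto_unitVec_of_isCompactOperator
    (isCompactOperator_of_locallyCompactSpace_dom g)

end Basic

section Scattered

variable {𝕜 : Type*} [RCLike 𝕜] {K : Type*} [TopologicalSpace K]
  [LocallyCompactSpace K] [T2Space K]

/-- A cutoff function at a point. -/
lemma exists_cutoff {p : K} {W : Set K} (hW : IsOpen W) (hp : p ∈ W) :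
    ∃ χ : C₀(K, 𝕜), ‖χ‖ ≤ 1 ∧ χ p = 1 ∧ ∀ x ∉ W, χ x = 0 := by
  obtain ⟨f, hf1, hf0, hfc, hf⟩ := exists_continuous_one_zero_of_isCompact
    (isCompact_singleton (x := p)) hW.isClosed_compl (by simpa using hp)
  refine ⟨ofCompactSupport f hfc, norm_le_of_forall zero_le_one fun x => ?_, ?_, fun x hx => ?_⟩
  · rw [ofCompactSupport_apply, RCLike.norm_ofReal, abs_of_nonneg (hf x).1]
    exact (hf x).2
  · have := hf1 (mem_singleton p)
    simp [this]
  · have := hf0 (show x ∈ Wᶜ from hx)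
    simp [this]

/-- On functions vanishing outside `O`, the functional `f` is approximated in norm by finitely
supported functionals. -/
def ApproxOn (f : C₀(K, 𝕜) →L[𝕜] 𝕜) (O : Set K) : Prop :=
  ∀ ε > 0, ∃ a ∈ Submodule.span 𝕜 (range (evalCLM 𝕜 : K → C₀(K, 𝕜) →L[𝕜] 𝕜)),
    ∀ h : C₀(K, 𝕜), (∀ x ∉ O, h x = 0) → ‖(f - a) h‖ ≤ ε * ‖h‖

omit [LocallyCompactSpace K] [T2Space K] in
/-- Almost all the variation of a functional on an open set is carried by a compact subset. -/
lemma exists_compact_carrier (f : C₀(K, 𝕜) →L[𝕜] 𝕜) (G : Set K) {ε : ℝ} (hε : 0 < ε) :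
    ∃ L : Set K, IsCompact L ∧ L ⊆ G ∧ ∀ h : C₀(K, 𝕜), (∀ x ∉ G, h x = 0) → (∀ x ∈ L, h x = 0) →
      ‖f h‖ ≤ ε * ‖h‖ := by
  set S : Set ℝ := {r | ∃ h : C₀(K, 𝕜), ‖h‖ ≤ 1 ∧ (∀ x ∉ G, h x = 0) ∧ r = ‖f h‖} with hS
  have hbd : ∀ r ∈ S, r ≤ ‖f‖ := by
    rintro r ⟨h, h1, -, rfl⟩
    exact (f.le_opNorm h).trans (mul_le_of_le_one_right (norm_nonneg _) h1)
  have hne : S.Nonempty := ⟨0, 0, by simp, by simp, by simp⟩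
  have hBdd : BddAbove S := ⟨_, hbd⟩
  set M := sSup S with hM
  have hM0 : 0 ≤ M := le_csSup hBdd ⟨0, by simp, by simp, by simp⟩
  obtain ⟨r, ⟨h₁, hn, hG, rfl⟩, hr⟩ := exists_lt_of_lt_csSup hne (sub_lt_self M (half_pos hε))
  set η : ℝ := ε / (2 * (M + 1)) with hη
  have hη0 : 0 < η := by positivity
  have hηM : η * M ≤ ε / 2 := by
    rw [hη, div_mul_eq_mul_div, div_le_div_iff₀ (by positivity) (by norm_num)]
    nlinarith
  obtain ⟨L', hL', hL'c⟩ : ∃ L' : Set K, IsCompact L' ∧ L'ᶜ ⊆ {x | ‖h₁ x‖ < η} := by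
    have h0 := h₁.zero_at_infty'
    have h1 := (Metric.tendsto_nhds.1 h0) η hη0
    obtain ⟨L', h2, h3⟩ := mem_cocompact.1 h1
    exact ⟨L', h2, fun x hx => by simpa using h3 hx⟩
  refine ⟨{x | η ≤ ‖h₁ x‖}, ?_, ?_, ?_⟩
  · refine hL'.of_isClosed_subset (isClosed_le continuous_const h₁.continuous.norm) fun x hx => ?_
    by_contra hx'
    exact (not_lt.2 (show η ≤ ‖h₁ x‖ from hx)) (hL'c hx')
  · intro x hx
    by_contra hx'
    have hx2 : η ≤ ‖h₁ x‖ := hx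
    rw [hG x hx', norm_zero] at hx2
    exact absurd hx2 (not_le.2 hη0)
  · intro h hhG hhL
    rcases eq_or_ne h 0 with rfl | hne0
    · simp
    have hpos : 0 < ‖h‖ := norm_pos_iff.2 hne0
    obtain ⟨c₁, hc₁, e₁⟩ := RCLike.exists_norm_eq_mul_self (f h₁)
    obtain ⟨c₂, hc₂, e₂⟩ := RCLike.exists_norm_eq_mul_self (f h)
    set g : C₀(K, 𝕜) := c₁ • h₁ + (c₂ / (‖h‖ : 𝕜)) • h with hg
    have hd : ‖c₂ / (‖h‖ : 𝕜)‖ * ‖h‖ = 1 := by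
      rw [norm_div, RCLike.norm_ofReal, abs_norm, hc₂, div_mul_cancel₀ _ hpos.ne']
    have hgn : ‖g‖ ≤ 1 + η := by
      refine norm_le_of_forall (by positivity) fun x => ?_
      have e3 : g x = c₁ * h₁ x + c₂ / (‖h‖ : 𝕜) * h x := rfl
      by_cases hx : η ≤ ‖h₁ x‖
      · rw [e3, hhL x hx, mul_zero, add_zero, norm_mul, hc₁, one_mul]
        linarith [norm_apply_le h₁ x]
      · rw [e3]
        refine (norm_add_le _ _).trans ?_
        rw [norm_mul, norm_mul, hc₁, one_mul]
        have := mul_le_mul_of_nonneg_left (norm_apply_le h x) (norm_nonneg (c₂ / (‖h‖ : 𝕜)))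
        linarith
    have hgG : ∀ x ∉ G, g x = 0 := by
      intro x hx
      have e3 : g x = c₁ * h₁ x + c₂ / (‖h‖ : 𝕜) * h x := rfl
      rw [e3, hG x hx, hhG x hx]; simp
    have hfg : f g = ((‖f h₁‖ + ‖f h‖ / ‖h‖ : ℝ) : 𝕜) := by
      rw [hg, map_add, map_smul, map_smul, smul_eq_mul, smul_eq_mul, div_mul_eq_mul_div, ← e₁, ← e₂]
      push_cast; rfl
    have hfgM : ‖f g‖ ≤ M * (1 + η) := by
      have hmem : ‖f (((1 + η : ℝ) : 𝕜)⁻¹ • g)‖ ∈ S := by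
        refine ⟨_, ?_, fun x hx => ?_, rfl⟩
        · rw [norm_smul, norm_inv, RCLike.norm_ofReal, abs_of_pos (by positivity)]
          rw [inv_mul_le_iff₀ (by positivity)]
          linarith
        · rw [ZeroAtInftyContinuousMap.smul_apply, hgG x hx, smul_zero]
      have h4 := le_csSup hBdd hmem
      rw [map_smul, norm_smul, norm_inv, RCLike.norm_ofReal, abs_of_pos (by positivity),
        inv_mul_le_iff₀ (by positivity)] at h4
      linarith
    rw [hfg, RCLike.norm_ofReal, abs_of_nonneg (by positivity)] at hfgM
    have : ‖f h‖ / ‖h‖ ≤ ε := by nlinarith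
    rwa [div_le_iff₀ hpos] at this

omit [LocallyCompactSpace K] [T2Space K] in
lemma span_evalCLM_comp_mul {a : C₀(K, 𝕜) →L[𝕜] 𝕜} (g : C₀(K, 𝕜))
    (ha : a ∈ Submodule.span 𝕜 (range (evalCLM 𝕜 : K → C₀(K, 𝕜) →L[𝕜] 𝕜))) :
    a ∘L ContinuousLinearMap.mul 𝕜 C₀(K, 𝕜) g ∈
      Submodule.span 𝕜 (range (evalCLM 𝕜 : K → C₀(K, 𝕜) →L[𝕜] 𝕜)) := by
  induction ha using Submodule.span_induction with
  | mem x hx =>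
    obtain ⟨k, rfl⟩ := hx
    have : evalCLM 𝕜 k ∘L ContinuousLinearMap.mul 𝕜 C₀(K, 𝕜) g = g k • evalCLM 𝕜 k := by
      ext h; simp
    rw [this]
    exact Submodule.smul_mem _ _ (Submodule.subset_span ⟨k, rfl⟩)
  | zero => simp
  | add x y _ _ hx hy => rw [ContinuousLinearMap.add_comp]; exact add_mem hx hy
  | smul c x _ hx => rw [ContinuousLinearMap.smul_comp]; exact Submodule.smul_mem _ _ hx

lemma ApproxOn.sUnion {f : C₀(K, 𝕜) →L[𝕜] 𝕜} {𝒢 : Set (Set K)}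
    (ho : ∀ O ∈ 𝒢, IsOpen O) (hg : ∀ O ∈ 𝒢, ApproxOn f O) : ApproxOn f (⋃₀ 𝒢) := by
  intro ε hε
  obtain ⟨L, hL, hLG, hfL⟩ := exists_compact_carrier f (⋃₀ 𝒢) (ε := ε / 4) (by positivity)
  obtain ⟨t, ht⟩ := hL.elim_finite_subcover (fun O : 𝒢 => (O : Set K)) (fun O => ho O O.2)
    (by rwa [← sUnion_eq_iUnion])
  let W : {O // O ∈ t} → Set K := fun i => i.1.1
  obtain ⟨ρ, hρ, hρc⟩ := PartitionOfUnity.exists_isSubordinate_of_locallyFinite_t2space hL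
    W (fun i => ho _ i.1.2) (locallyFinite_of_finite _) (by
      intro x hx
      obtain ⟨O, hO, hxO⟩ := mem_iUnion₂.1 (ht hx)
      exact mem_iUnion.2 ⟨⟨O, hO⟩, hxO⟩)
  set g : {O // O ∈ t} → C₀(K, 𝕜) := fun i => ofCompactSupport (ρ i) (hρc i) with hgdef
  have hgx : ∀ i x, g i x = ((ρ i x : ℝ) : 𝕜) := fun i x => rfl
  have hgO : ∀ i, ∀ x ∉ W i, g i x = 0 := by
    intro i x hx
    rw [hgx, image_eq_zero_of_notMem_tsupport fun h => hx (hρ i h), RCLike.ofReal_zero]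
  have hg1 : ∀ i, ‖g i‖ ≤ 1 := fun i => norm_le_of_forall zero_le_one fun x => by
    rw [hgx, RCLike.norm_ofReal, abs_of_nonneg (ρ.nonneg i x)]
    exact ρ.le_one i x
  have hsum : ∀ x, (∑ i, g i) x = ((∑ i, ρ i x : ℝ) : 𝕜) := by
    intro x
    rw [sum_apply]; push_cast; rfl
  have hpos : 0 < ε / (2 * (Fintype.card t + 1)) := by positivity
  choose a ha hfa using fun i : {O // O ∈ t} => hg _ i.1.2 _ hpos
  refine ⟨∑ i, a i ∘L ContinuousLinearMap.mul 𝕜 C₀(K, 𝕜) (g i),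
    sum_mem fun i _ => span_evalCLM_comp_mul _ (ha i), fun h hh => ?_⟩
  have hdec : (f - ∑ i, a i ∘L ContinuousLinearMap.mul 𝕜 C₀(K, 𝕜) (g i)) h
      = f (h - (∑ i, g i) * h) + ∑ i, (f - a i) (g i * h) := by
    simp [Finset.sum_mul, sub_apply]
  have h1 : ‖f (h - (∑ i, g i) * h)‖ ≤ ε / 4 * ‖h - (∑ i, g i) * h‖ := by
    refine hfL _ (fun x hx => ?_) (fun x hx => ?_)
    · simp [hh x hx]
    · have h2 := ρ.sum_eq_one hx
      rw [finsum_eq_sum_of_fintype] at h2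
      rw [ZeroAtInftyContinuousMap.sub_apply, ZeroAtInftyContinuousMap.mul_apply, hsum, h2]
      simp
  have h2 : ‖h - (∑ i, g i) * h‖ ≤ ‖h‖ := by
    refine norm_le_of_forall (norm_nonneg _) fun x => ?_
    have h3 := ρ.sum_le_one x
    rw [finsum_eq_sum_of_fintype] at h3
    have h4 : 0 ≤ ∑ i, ρ i x := Finset.sum_nonneg fun i _ => ρ.nonneg i x
    have h5 : (h - (∑ i, g i) * h) x = ((1 - ∑ i, ρ i x : ℝ) : 𝕜) * h x := by
      rw [ZeroAtInftyContinuousMap.sub_apply, ZeroAtInftyContinuousMap.mul_apply, hsum]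
      push_cast; ring
    rw [h5, norm_mul, RCLike.norm_ofReal, abs_of_nonneg (by linarith)]
    exact (mul_le_of_le_one_left (norm_nonneg _) (by linarith)).trans (norm_apply_le h x)
  have h3 : ∀ i, ‖(f - a i) (g i * h)‖ ≤ ε / (2 * (Fintype.card t + 1)) * ‖h‖ := by
    intro i
    refine (hfa i _ fun x hx => by simp [hgO i x hx]).trans
      (mul_le_mul_of_nonneg_left ?_ hpos.le)
    exact (norm_mul_le _ _).trans (mul_le_of_le_one_left (norm_nonneg _) (hg1 i))
  have h4 : ‖∑ i, (f - a i) (g i * h)‖ ≤ ε / 2 * ‖h‖ := by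
    refine (norm_sum_le_of_le _ fun i _ => h3 i).trans ?_
    rw [Finset.sum_const, Finset.card_univ, nsmul_eq_mul, ← mul_assoc]
    refine mul_le_mul_of_nonneg_right ?_ (norm_nonneg _)
    rw [mul_div_assoc', div_le_div_iff₀ (by positivity) (by norm_num)]
    nlinarith
  rw [hdec]
  refine (norm_add_le _ _).trans ?_
  have := norm_nonneg h
  nlinarith

lemma ApproxOn.insert {f : C₀(K, 𝕜) →L[𝕜] 𝕜} {G W : Set K} {p : K} (hG : ApproxOn f G)
    (hW : IsOpen W) (hp : p ∈ W) (hWG : W ⊆ insert p G) : ApproxOn f (G ∪ W) := by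
  intro ε hε
  obtain ⟨a, ha, hfa⟩ := hG (ε / 2) (by positivity)
  obtain ⟨χ, hχ1, hχp, hχ0⟩ := exists_cutoff (𝕜 := 𝕜) hW hp
  refine ⟨a + (f - a) χ • evalCLM 𝕜 p, add_mem ha (Submodule.smul_mem _ _
    (Submodule.subset_span ⟨p, rfl⟩)), fun h hh => ?_⟩
  have h1 : (f - (a + (f - a) χ • evalCLM 𝕜 p)) h = (f - a) (h - h p • χ) := by
    simp only [sub_apply, add_apply, smul_apply, map_sub, map_smul, evalCLM_apply, smul_eq_mul]
    ring
  rw [h1]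
  refine (hfa _ fun x hx => ?_).trans ?_
  · have e : (h - h p • χ) x = h x - h p * χ x := rfl
    rw [e]
    by_cases hxp : x = p
    · rw [hxp, hχp]; simp
    · have hxW : x ∉ W := fun hxW => (hWG hxW).elim hxp hx
      rw [hχ0 x hxW, hh x (by simp [hx, hxW])]; simp
  · have : ‖h - h p • χ‖ ≤ ‖h‖ + ‖h‖ := by
      refine (norm_sub_le _ _).trans (add_le_add le_rfl ?_)
      rw [norm_smul]
      exact (mul_le_mul (norm_apply_le h p) hχ1 (norm_nonneg _) (norm_nonneg _)).trans_eq
        (mul_one _)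
    nlinarith

/-- On a scattered space, finitely supported functionals are norm dense in the dual of
`C₀(K, 𝕜)`. -/
lemma exists_span_norm_sub_le
    (h_scattered : ∀ S : Set K, S.Nonempty → ∃ x ∈ S, ∃ U : Set K, IsOpen U ∧ U ∩ S = {x})
    (f : C₀(K, 𝕜) →L[𝕜] 𝕜) {ε : ℝ} (hε : 0 < ε) :
    ∃ a ∈ Submodule.span 𝕜 (range (evalCLM 𝕜 : K → C₀(K, 𝕜) →L[𝕜] 𝕜)), ‖f - a‖ ≤ ε := by
  set 𝒢 : Set (Set K) := {O | IsOpen O ∧ ApproxOn f O} with h𝒢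
  have hU : ApproxOn f (⋃₀ 𝒢) := ApproxOn.sUnion (fun O hO => hO.1) (fun O hO => hO.2)
  have huniv : ⋃₀ 𝒢 = univ := by
    by_contra hne
    obtain ⟨p, hp, W, hW, hWp⟩ := h_scattered (⋃₀ 𝒢)ᶜ (nonempty_compl.2 hne)
    have hpW : p ∈ W := (hWp.ge (mem_singleton p)).1
    have hmem : ⋃₀ 𝒢 ∪ W ∈ 𝒢 := by
      refine ⟨(isOpen_sUnion fun O hO => hO.1).union hW, hU.insert hW hpW fun x hx => ?_⟩
      by_cases hxG : x ∈ ⋃₀ 𝒢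
      · exact Or.inr hxG
      · exact Or.inl (hWp.le ⟨hx, hxG⟩)
    exact hp (mem_sUnion.2 ⟨_, hmem, Or.inr hpW⟩)
  obtain ⟨a, ha, hfa⟩ := hU ε hε
  exact ⟨a, ha, ContinuousLinearMap.opNorm_le_bound _ hε.le fun h => hfa h (by simp [huniv])⟩

omit [T2Space K] in
/-- Every sequence in a scattered locally compact space has a subsequence along which every
function in `C₀(K, 𝕜)` converges. -/
lemma exists_subseq_tendsto_apply
    (h_scattered : ∀ S : Set K, S.Nonempty → ∃ x ∈ S, ∃ U : Set K, IsOpen U ∧ U ∩ S = {x})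
    (k : ℕ → K) : ∃ φ : ℕ → ℕ, StrictMono φ ∧
      ∀ h : C₀(K, 𝕜), ∃ l, Tendsto (fun n => h (k (φ n))) atTop (𝓝 l) := by
  rcases Set.eq_empty_or_nonempty {p | MapClusterPt p atTop k} with hC | hC
  · refine ⟨id, strictMono_id, fun h => ⟨0, ?_⟩⟩
    refine Tendsto.comp h.zero_at_infty' ?_
    rw [tendsto_def]
    intro s hs
    obtain ⟨L, hL, hLs⟩ := mem_cocompact.1 hs
    by_contra hcon
    have hfr : ∃ᶠ n in atTop, k n ∈ L := by
      intro hev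
      refine hcon (mem_of_superset hev fun n hn => hLs hn)
    obtain ⟨a, -, ha⟩ := hL.exists_mapClusterPt_of_frequently hfr
    exact (hC.le (show a ∈ {p | MapClusterPt p atTop k} from ha)).elim
  · obtain ⟨p, hp, U, hU, hUp⟩ := h_scattered _ hC
    have hpU : p ∈ U := (hUp.ge (mem_singleton p)).1
    obtain ⟨W, hW, hWU, hWc⟩ := local_compact_nhds (hU.mem_nhds hpU)
    have hfr : ∃ᶠ n in atTop, k n ∈ W := (show MapClusterPt p atTop k from hp).frequently hW
    obtain ⟨φ, hφ, hφW⟩ := extraction_of_frequently_atTop hfr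
    have ht : Tendsto (k ∘ φ) atTop (𝓝 p) := by
      refine hWc.tendsto_nhds_of_unique_mapClusterPt (Eventually.of_forall hφW) fun x hx hxc => ?_
      exact hUp.le ⟨hWU hx, MapClusterPt.of_comp hφ.tendsto_atTop hxc⟩
    exact ⟨φ, hφ, fun h => ⟨h p, (h.continuous.tendsto p).comp ht⟩⟩

end Scattered

lemma exists_seq_of_forall_finset_exists_level {β : Type*} (P : β → Prop) (r : ℕ → β → β → Prop)
    (h : ∀ (N : ℕ) (s : Finset β), (∀ x ∈ s, P x) → ∃ y, P y ∧ ∀ x ∈ s, r N x y)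
    (hmono : ∀ M N x y, N ≤ M → r M x y → r N x y) :
    ∃ f : ℕ → β, (∀ n, P (f n)) ∧ ∀ m n, m < n → r n (f m) (f n) := by
  classical
  obtain ⟨f, hf, hr⟩ := exists_seq_of_forall_finset_exists (fun a : ℕ × β => P a.2)
    (fun a b => a.1 < b.1 ∧ r b.1 a.2 b.2) (fun s hs => by
      obtain ⟨y, hy, hry⟩ := h (s.sup Prod.fst + 1) (s.image Prod.snd) (by
        intro x hx
        obtain ⟨a, ha, rfl⟩ := Finset.mem_image.1 hx
        exact hs a ha)
      exact ⟨(_, y), hy, fun a ha => ⟨Nat.lt_succ_of_le (Finset.le_sup (f := Prod.fst) ha),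
        hry _ (Finset.mem_image_of_mem _ ha)⟩⟩)
  have hmon : StrictMono fun n => (f n).1 := fun m n hmn => (hr m n hmn).1
  exact ⟨fun n => (f n).2, hf, fun m n hmn => hmono _ _ _ _ (hmon.id_le n) (hr m n hmn).2⟩

/-- A double sequence with null rows and columns becomes almost diagonal on a subsequence. -/
lemma exists_subseq_offDiagonal_le {E : Type*} [SeminormedAddCommGroup E] (w : ℕ → ℕ → E)
    (hrow : ∀ i, Tendsto (fun j => w i j) atTop (𝓝 0))
    (hcol : ∀ j, Tendsto (fun i => w i j) atTop (𝓝 0))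
    {P : ℕ → Prop} (hP : ∃ᶠ n in atTop, P n) :
    ∃ φ : ℕ → ℕ, StrictMono φ ∧ (∀ n, P (φ n)) ∧
      ∀ i j, i ≠ j → ‖w (φ i) (φ j)‖ ≤ (1 / 2) ^ max i j := by
  obtain ⟨φ, hφ, hr⟩ := exists_seq_of_forall_finset_exists_level P
    (fun N m n => m < n ∧ ‖w m n‖ ≤ (1 / 2) ^ N ∧ ‖w n m‖ ≤ (1 / 2) ^ N) (fun N s _ => by
      have hev : ∀ᶠ n in atTop, ∀ m ∈ s, m < n ∧ ‖w m n‖ ≤ (1 / 2 : ℝ) ^ N ∧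
          ‖w n m‖ ≤ (1 / 2 : ℝ) ^ N := by
        rw [Filter.eventually_all_finset]
        intro m _
        have hN : (0 : ℝ) < (1 / 2) ^ N := by positivity
        refine (eventually_gt_atTop m).and (Eventually.and ?_ ?_)
        · have h1 := (hrow m).norm
          rw [norm_zero] at h1
          exact h1.eventually (eventually_le_nhds hN)
        · have h1 := (hcol m).norm
          rw [norm_zero] at h1
          exact h1.eventually (eventually_le_nhds hN)
      exact (hP.and_eventually hev).exists) (fun M N m n hNM h => by
      have h1 : (1 / 2 : ℝ) ^ M ≤ (1 / 2) ^ N :=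
        pow_le_pow_of_le_one (by norm_num) (by norm_num) hNM
      exact ⟨h.1, h.2.1.trans h1, h.2.2.trans h1⟩)
  refine ⟨φ, fun m n hmn => (hr m n hmn).1, hφ, fun i j hij => ?_⟩
  rcases lt_or_gt_of_ne hij with h | h
  · rw [max_eq_right h.le]; exact (hr i j h).2.1
  · rw [max_eq_left h.le]; exact (hr j i h).2.2

section Copies

variable {𝕜 : Type*} [RCLike 𝕜] {E : Type*} [NormedAddCommGroup E] [NormedSpace 𝕜 E]

/-- An absolutely convergent series of rank one operators is compact. -/
lemma isCompactOperator_of_hasSum_rankOne {F : Type*} [NormedAddCommGroup F] [NormedSpace 𝕜 F]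
    [CompleteSpace E] {f : ℕ → F →L[𝕜] 𝕜} (hf : ∀ n, ‖f n‖ ≤ 1) {x : ℕ → E}
    (hx : Summable fun n => ‖x n‖) {R : F →L[𝕜] E} (hR : ∀ a, HasSum (fun n => f n a • x n) (R a)) :
    IsCompactOperator R := by
  set S : ℕ → F →L[𝕜] E := fun n => (ContinuousLinearMap.toSpanSingleton 𝕜 (x n)) ∘L f n with hS
  have hSn : ∀ n, ‖S n‖ ≤ ‖x n‖ := by
    intro n
    refine (ContinuousLinearMap.opNorm_comp_le _ _).trans ?_
    rw [ContinuousLinearMap.norm_toSpanSingleton]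
    exact mul_le_of_le_one_right (norm_nonneg _) (hf n)
  have hsum : Summable S := Summable.of_norm_bounded hx hSn
  have hRS : ∑' n, S n = R := by
    ext a
    exact (hsum.hasSum.mapL (ContinuousLinearMap.apply 𝕜 E a)).unique (hR a)
  have ht := hsum.hasSum
  rw [hRS, HasSum, SummationFilter.unconditional_filter] at ht
  refine isCompactOperator_of_tendsto ht (Eventually.of_forall fun s => ?_)
  refine (compactOperator (RingHom.id 𝕜) F E).sum_mem (t := s) (f := S) fun n _ => ?_
  exact (isCompactOperator_of_locallyCompactSpace_rng
    (ContinuousLinearMap.toSpanSingleton 𝕜 (x n))).comp_clm (f n)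

/-- An operator out of `c₀` whose values on the unit vector basis are absolutely summable is
compact. -/
lemma isCompactOperator_of_summable [CompleteSpace E] (R : C₀(ℕ, 𝕜) →L[𝕜] E)
    (hR : Summable fun n => ‖R (unitVec 𝕜 n)‖) : IsCompactOperator R := by
  refine isCompactOperator_of_hasSum_rankOne (f := evalCLM 𝕜) norm_evalCLM_le hR fun a => ?_
  have h := (hasSum_unitVec a).mapL R
  simp only [map_smul] at h
  exact h

lemma opNorm_pos {F : Type*} [NormedAddCommGroup F] [NormedSpace 𝕜 F]
    {V : F →L[𝕜] E} (hV : V ≠ 0) : 0 < ‖V‖ := norm_pos_iff.2 hV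

lemma opNorm_inv_smul_le {F : Type*} [NormedAddCommGroup F] [NormedSpace 𝕜 F]
    (V : F →L[𝕜] E) : ‖((‖V‖ : ℝ) : 𝕜)⁻¹ • V‖ ≤ 1 := by
  rw [norm_smul, norm_inv, RCLike.norm_ofReal, abs_norm]
  exact inv_mul_le_one

lemma not_isCompactOperator_id :
    ¬ IsCompactOperator (ContinuousLinearMap.id 𝕜 C₀(ℕ, 𝕜)) := by
  intro h
  have h1 := (tendsto_unitVec_of_isCompactOperator h).norm
  rw [norm_zero] at h1
  obtain ⟨n, hn⟩ := (h1.eventually (gt_mem_nhds one_pos)).exists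
  have h2 := norm_apply_le (unitVec 𝕜 n) n
  rw [unitVec_apply, if_pos rfl, norm_one] at h2
  exact absurd hn (not_lt.2 h2)

/-- There is a weak* null sequence in the dual unit ball and a contraction from `c₀` such
that the diagonal of the resulting matrix of `T` is frequently at least `δ` in modulus. -/
def FixesCopy (T : E →L[𝕜] E) (δ : ℝ) : Prop :=
  ∃ (u : ℕ → E →L[𝕜] 𝕜) (V : C₀(ℕ, 𝕜) →L[𝕜] E), (∀ n, ‖u n‖ ≤ 1) ∧
    (∀ x, Tendsto (fun n => u n x) atTop (𝓝 0)) ∧ ‖V‖ ≤ 1 ∧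
    ∃ᶠ n in atTop, δ ≤ ‖u n (T (V (unitVec 𝕜 n)))‖

variable {T T₁ T₂ : E →L[𝕜] E} {δ : ℝ}

lemma FixesCopy.exists_almost_diagonal (h : FixesCopy T δ) :
    ∃ (u : ℕ → E →L[𝕜] 𝕜) (V : C₀(ℕ, 𝕜) →L[𝕜] E), (∀ n, ‖u n‖ ≤ 1) ∧
      (∀ x, Tendsto (fun n => u n x) atTop (𝓝 0)) ∧ ‖V‖ ≤ 1 ∧
      (∀ n, δ ≤ ‖u n (T (V (unitVec 𝕜 n)))‖) ∧
      ∀ i j, i ≠ j → ‖u i (T (V (unitVec 𝕜 j)))‖ ≤ (1 / 2) ^ max i j := by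
  obtain ⟨u, V, hu, hu0, hV, hfr⟩ := h
  obtain ⟨φ, hφ, hδ, hoff⟩ := exists_subseq_offDiagonal_le (fun i j => u i (T (V (unitVec 𝕜 j))))
    (fun i => tendsto_functional_unitVec (u i ∘L T ∘L V)) (fun j => hu0 _) hfr
  obtain ⟨J, hJ, hJe⟩ := exists_clm_of_disjoint (fun n => unitVec 𝕜 (φ n))
    (fun n => norm_unitVec_le _) (fun i j hij x => by
      simp only [unitVec_apply]
      by_cases hx : x = φ i
      · exact Or.inr (if_neg fun hx' => hij (hφ.injective (hx.symm.trans hx')))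
      · exact Or.inl (if_neg hx))
  refine ⟨fun n => u (φ n), V ∘L J, fun n => hu _, fun x => (hu0 x).comp hφ.tendsto_atTop,
    (ContinuousLinearMap.opNorm_comp_le _ _).trans (mul_le_one₀ hV (norm_nonneg _) hJ),
    fun n => ?_, fun i j hij => ?_⟩
  · simpa [hJe] using hδ n
  · simpa [hJe] using hoff i j hij

lemma FixesCopy.exists_factorization (h : FixesCopy T δ) (hδ : 0 < δ) :
    ∃ (U : E →L[𝕜] C₀(ℕ, 𝕜)) (V : C₀(ℕ, 𝕜) →L[𝕜] E),
      IsCompactOperator ⇑(ContinuousLinearMap.id 𝕜 (C₀(ℕ, 𝕜)) - U ∘L T ∘L V) ∧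
      δ ≤ 1 / (‖U‖ * ‖V‖) := by
  obtain ⟨u, V, hu, hu0, hV, hd, hoff⟩ := h.exists_almost_diagonal
  set d : ℕ → 𝕜 := fun n => u n (T (V (unitVec 𝕜 n))) with hdef
  have hdinv : ∀ n, ‖(d n)⁻¹‖ ≤ δ⁻¹ := fun n => by
    rw [norm_inv]; exact inv_anti₀ hδ (hd n)
  have hd0 : ∀ n, d n ≠ 0 := fun n => norm_pos_iff.1 (hδ.trans_le (hd n))
  obtain ⟨U, hU, hUa⟩ := exists_clm_of_tendsto (fun n => (d n)⁻¹ • u n) (C := δ⁻¹)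
    (by positivity) (fun n => by
      rw [norm_smul]
      exact (mul_le_mul (hdinv n) (hu n) (norm_nonneg _) (by positivity)).trans_eq (mul_one _))
    (fun x => by
      refine squeeze_zero_norm (a := fun n => δ⁻¹ * ‖u n x‖) (fun n => ?_) ?_
      · rw [smul_apply, norm_smul]
        exact mul_le_mul_of_nonneg_right (hdinv n) (norm_nonneg _)
      · simpa using (hu0 x).norm.const_mul δ⁻¹)
  have hcomp : IsCompactOperator ⇑(ContinuousLinearMap.id 𝕜 (C₀(ℕ, 𝕜)) - U ∘L T ∘L V) := by
    refine isCompactOperator_of_summable _ (Summable.of_nonneg_of_le (fun _ => norm_nonneg _)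
      (fun j => ?_) ((summable_geometric_of_lt_one (r := (1 / 2 : ℝ)) (by norm_num)
        (by norm_num)).mul_left δ⁻¹))
    refine norm_le_of_forall (by positivity) fun i => ?_
    have e : (ContinuousLinearMap.id 𝕜 (C₀(ℕ, 𝕜)) - U ∘L T ∘L V) (unitVec 𝕜 j) i
        = unitVec 𝕜 j i - (d i)⁻¹ * u i (T (V (unitVec 𝕜 j))) := by
      have := hUa (T (V (unitVec 𝕜 j))) i
      rw [smul_apply, smul_eq_mul] at this
      rw [← this]; rfl
    rw [e, unitVec_apply]
    split_ifs with hij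
    · subst hij
      change ‖1 - (d i)⁻¹ * d i‖ ≤ _
      rw [inv_mul_cancel₀ (hd0 i), sub_self, norm_zero]
      positivity
    · rw [zero_sub, norm_neg, norm_mul]
      refine mul_le_mul (hdinv i) ((hoff i j hij).trans ?_) (norm_nonneg _) (by positivity)
      exact pow_le_pow_of_le_one (by norm_num) (by norm_num) (le_max_right i j)
  refine ⟨U, V, hcomp, ?_⟩
  have hpos : 0 < ‖U‖ * ‖V‖ := by
    refine mul_pos (opNorm_pos ?_) (opNorm_pos ?_)
    · rintro rfl
      simp at hcomp
      exact not_isCompactOperator_id hcomp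
    · rintro rfl
      simp at hcomp
      exact not_isCompactOperator_id hcomp
  rw [le_div_iff₀ hpos]
  calc δ * (‖U‖ * ‖V‖) ≤ δ * (δ⁻¹ * 1) := by gcongr
    _ = 1 := by rw [mul_one, mul_inv_cancel₀ hδ.ne']

lemma fixesCopy_of_isCompactOperator {U : E →L[𝕜] C₀(ℕ, 𝕜)} {V : C₀(ℕ, 𝕜) →L[𝕜] E}
    (h : IsCompactOperator ⇑(ContinuousLinearMap.id 𝕜 (C₀(ℕ, 𝕜)) - U ∘L T ∘L V))
    (hδ : δ < 1 / (‖U‖ * ‖V‖)) : FixesCopy T δ := by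
  have ht := tendsto_unitVec_of_isCompactOperator h
  have hU : 0 < ‖U‖ := by
    refine opNorm_pos ?_
    rintro rfl
    simp at h
    exact not_isCompactOperator_id h
  have hV : 0 < ‖V‖ := by
    refine opNorm_pos ?_
    rintro rfl
    simp at h
    exact not_isCompactOperator_id h
  refine ⟨fun n => ((‖U‖ : ℝ) : 𝕜)⁻¹ • (evalCLM 𝕜 n ∘L U), ((‖V‖ : ℝ) : 𝕜)⁻¹ • V, fun n => ?_, fun x => ?_,
    ?_, Eventually.frequently ?_⟩
  · rw [norm_smul, norm_inv, RCLike.norm_ofReal, abs_of_pos hU, inv_mul_le_iff₀ hU, mul_one]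
    exact (ContinuousLinearMap.opNorm_comp_le _ _).trans
      (mul_le_of_le_one_left hU.le (norm_evalCLM_le n))
  · simpa using (tendsto_zeroAtInfty_nat (U x)).const_mul ((‖U‖ : ℝ) : 𝕜)⁻¹
  · exact opNorm_inv_smul_le V
  · have h1 : ∀ n, 1 - ‖(ContinuousLinearMap.id 𝕜 (C₀(ℕ, 𝕜)) - U ∘L T ∘L V) (unitVec 𝕜 n)‖ ≤
        ‖U (T (V (unitVec 𝕜 n))) n‖ := by
      intro n
      have h2 := norm_apply_le
        ((ContinuousLinearMap.id 𝕜 (C₀(ℕ, 𝕜)) - U ∘L T ∘L V) (unitVec 𝕜 n)) n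
      have e : (ContinuousLinearMap.id 𝕜 (C₀(ℕ, 𝕜)) - U ∘L T ∘L V) (unitVec 𝕜 n) n
          = 1 - U (T (V (unitVec 𝕜 n))) n := by
        have : unitVec 𝕜 n n = 1 := by simp [unitVec_apply]
        rw [← this]; rfl
      rw [e] at h2
      have h3 := norm_sub_norm_le (1 : 𝕜) (U (T (V (unitVec 𝕜 n))) n)
      rw [norm_one] at h3
      linarith
    rw [lt_div_iff₀ (by positivity)] at hδ
    have h4 := ht.norm
    rw [norm_zero] at h4
    filter_upwards [h4.eventually (gt_mem_nhds (sub_pos.2 hδ))] with n hn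
    have e : ‖(((‖U‖ : ℝ) : 𝕜)⁻¹ • (evalCLM 𝕜 n ∘L U)) (T ((((‖V‖ : ℝ) : 𝕜)⁻¹ • V) (unitVec 𝕜 n)))‖
        = ‖U (T (V (unitVec 𝕜 n))) n‖ / (‖U‖ * ‖V‖) := by
      simp only [smul_apply, map_smul, ContinuousLinearMap.comp_apply, evalCLM_apply, norm_mul,
        norm_inv, RCLike.norm_ofReal, smul_eq_mul, abs_of_pos hU, abs_of_pos hV]
      field_simp
    rw [e, le_div_iff₀ (by positivity)]
    linarith [h1 n]

lemma norm_unitVec_matrix_le {u : E →L[𝕜] 𝕜} {V : C₀(ℕ, 𝕜) →L[𝕜] E} (hu : ‖u‖ ≤ 1)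
    (hV : ‖V‖ ≤ 1) (T : E →L[𝕜] E) (n : ℕ) : ‖u (T (V (unitVec 𝕜 n)))‖ ≤ ‖T‖ := by
  have h1 : ‖V (unitVec 𝕜 n)‖ ≤ 1 :=
    (V.le_of_opNorm_le hV _).trans (by simpa using norm_unitVec_le n)
  refine (u.le_of_opNorm_le hu _).trans ?_
  rw [one_mul]
  exact (T.le_opNorm _).trans (mul_le_of_le_one_right (norm_nonneg _) h1)

lemma FixesCopy.le_norm (h : FixesCopy T δ) : δ ≤ ‖T‖ := by
  obtain ⟨u, V, hu, -, hV, hfr⟩ := h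
  obtain ⟨n, hn⟩ := hfr.exists
  exact hn.trans (norm_unitVec_matrix_le (hu n) hV T n)

lemma FixesCopy.le_zero_of_isCompactOperator (h : FixesCopy T δ) (hT : IsCompactOperator T) :
    δ ≤ 0 := by
  obtain ⟨u, V, hu, -, hV, hfr⟩ := h
  have h1 := (tendsto_unitVec_of_isCompactOperator (S := T ∘L V) (hT.comp_clm V)).norm
  rw [norm_zero] at h1
  refine ge_of_tendsto_of_frequently h1 (hfr.mono fun n hn => hn.trans ?_)
  exact ((u n).le_of_opNorm_le (hu n) _).trans_eq (one_mul _)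

lemma FixesCopy.smul (h : FixesCopy T δ) (c : 𝕜) : FixesCopy (c • T) (‖c‖ * δ) := by
  obtain ⟨u, V, hu, hu0, hV, hfr⟩ := h
  refine ⟨u, V, hu, hu0, hV, hfr.mono fun n hn => ?_⟩
  rw [smul_apply, map_smul, norm_smul]
  exact mul_le_mul_of_nonneg_left hn (norm_nonneg c)

lemma FixesCopy.mono {δ' : ℝ} (h : FixesCopy T δ) (hδ : δ' ≤ δ) : FixesCopy T δ' := by
  obtain ⟨u, V, hu, hu0, hV, hfr⟩ := h
  exact ⟨u, V, hu, hu0, hV, hfr.mono fun n hn => hδ.trans hn⟩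

lemma FixesCopy.of_add {δ₁ δ₂ : ℝ} (h : FixesCopy (T₁ + T₂) (δ₁ + δ₂)) :
    FixesCopy T₁ δ₁ ∨ FixesCopy T₂ δ₂ := by
  obtain ⟨u, V, hu, hu0, hV, hfr⟩ := h
  by_cases h1 : ∃ᶠ n in atTop, δ₁ ≤ ‖u n (T₁ (V (unitVec 𝕜 n)))‖
  · exact Or.inl ⟨u, V, hu, hu0, hV, h1⟩
  · refine Or.inr ⟨u, V, hu, hu0, hV, (hfr.and_eventually (not_frequently.1 h1)).mono ?_⟩
    rintro n ⟨hn, hn1⟩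
    rw [add_apply, map_add] at hn
    linarith [norm_add_le (u n (T₁ (V (unitVec 𝕜 n)))) (u n (T₂ (V (unitVec 𝕜 n))))]

end Copies

lemma sum_biUnion_le {α ι : Type*} [DecidableEq α] {g : α → ℝ} (s : Finset ι) (t : ι → Finset α)
    (hg : ∀ x, 0 ≤ g x) : ∑ x ∈ s.biUnion t, g x ≤ ∑ i ∈ s, ∑ x ∈ t i, g x := by
  classical
  induction s using Finset.induction_on with
  | empty => simp
  | insert i s his ih =>
    rw [Finset.biUnion_insert, Finset.sum_insert his]
    have h1 := Finset.sum_union_inter (s₁ := t i) (s₂ := s.biUnion t) (f := g)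
    have h2 : 0 ≤ ∑ x ∈ t i ∩ s.biUnion t, g x := Finset.sum_nonneg fun x _ => hg x
    linarith

section Discrete

variable {𝕜 : Type*} [RCLike 𝕜] {K : Type*} [TopologicalSpace K]

variable (𝕜 K) in
/-- The functional on `C₀(K, 𝕜)` given by a finitely supported measure. -/
noncomputable def finMeasure : (K →₀ 𝕜) →ₗ[𝕜] C₀(K, 𝕜) →L[𝕜] 𝕜 :=
  Finsupp.linearCombination 𝕜 (evalCLM 𝕜)

lemma finMeasure_apply {b : K →₀ 𝕜} {s : Finset K} (hs : b.support ⊆ s) (h : C₀(K, 𝕜)) :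
    finMeasure 𝕜 K b h = ∑ x ∈ s, b x * h x := by
  rw [finMeasure, Finsupp.linearCombination_apply, Finsupp.sum_of_support_subset _ hs _ (by simp)]
  simp

lemma norm_finMeasure_le {b : K →₀ 𝕜} {s : Finset K} (hs : b.support ⊆ s) :
    ‖finMeasure 𝕜 K b‖ ≤ ∑ x ∈ s, ‖b x‖ := by
  refine ContinuousLinearMap.opNorm_le_bound _ (Finset.sum_nonneg fun _ _ => norm_nonneg _)
    fun h => ?_
  rw [finMeasure_apply hs, Finset.sum_mul]
  refine norm_sum_le_of_le _ fun x _ => ?_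
  rw [norm_mul]
  exact mul_le_mul_of_nonneg_left (norm_apply_le h x) (norm_nonneg _)

variable [LocallyCompactSpace K] [T2Space K]

/-- A function in the unit ball, supported in a closed subset of a prescribed open set, with
prescribed phases on a finite set. -/
lemma exists_phase_function (F : Finset K) {O : Set K} (hO : IsOpen O) (hF : ∀ x ∈ F, x ∈ O)
    (c : K → 𝕜) : ∃ (v : C₀(K, 𝕜)) (G : Set K), ‖v‖ ≤ 1 ∧ IsClosed G ∧ G ⊆ O ∧
      (∀ x ∉ G, v x = 0) ∧ ∀ x ∈ F, c x * v x = (‖c x‖ : 𝕜) := by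
  obtain ⟨U, hU, hUd⟩ := F.finite_toSet.t2_separation
  have hW : ∀ x : F, ∃ W : Set K, IsOpen W ∧ (x : K) ∈ W ∧ closure W ⊆ U x ∩ O := by
    intro x
    obtain ⟨W, hW, hxW, hWc, -⟩ := exists_open_between_and_isCompact_closure
      (isCompact_singleton (x := (x : K))) ((hU x).2.inter hO)
      (singleton_subset_iff.2 ⟨(hU x).1, hF x x.2⟩)
    exact ⟨W, hW, singleton_subset_iff.1 hxW, hWc⟩
  choose W hWo hxW hWU using hW
  choose χ hχ1 hχx hχ0 using fun x : F => exists_cutoff (𝕜 := 𝕜) (hWo x) (hxW x)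
  choose d hd hdc using fun x : K => RCLike.exists_norm_eq_mul_self (c x)
  have hzero : ∀ (x : F) (y : K), χ x y ≠ 0 → y ∈ U x ∩ O := by
    intro x y hy
    by_contra h
    exact hy (hχ0 x y fun hyW => h (hWU x (subset_closure hyW)))
  have huniq : ∀ (x z : F) (y : K), χ x y ≠ 0 → χ z y ≠ 0 → x = z := by
    intro x z y hx hz
    by_contra hne
    exact disjoint_left.1 (hUd x.2 z.2 fun h => hne (Subtype.ext h)) (hzero x y hx).1
      (hzero z y hz).1
  have hval : ∀ (x : F) (y : K), χ x y ≠ 0 → (∑ z : F, d z • χ z) y = d x * χ x y := by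
    intro x y hx
    rw [sum_apply, Finset.sum_eq_single_of_mem x (Finset.mem_univ _)]
    · rfl
    · intro z _ hzx
      have : χ z y = 0 := by
        by_contra hz
        exact hzx (huniq z x y hz hx)
      rw [ZeroAtInftyContinuousMap.smul_apply, this, smul_zero]
  have hval0 : ∀ y : K, (∀ x : F, χ x y = 0) → (∑ z : F, d z • χ z) y = 0 := by
    intro y hy
    rw [sum_apply]
    exact Finset.sum_eq_zero fun z _ => by
      rw [ZeroAtInftyContinuousMap.smul_apply, hy z, smul_zero]
  refine ⟨∑ z : F, d z • χ z, ⋃ x : F, closure (W x), norm_le_of_forall zero_le_one fun y => ?_,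
    isClosed_iUnion_of_finite fun _ => isClosed_closure,
    iUnion_subset fun x => (hWU x).trans inter_subset_right, fun y hy => hval0 y fun x => ?_,
    fun x hx => ?_⟩
  · by_cases hy : ∃ x : F, χ x y ≠ 0
    · obtain ⟨x, hx⟩ := hy
      rw [hval x y hx, norm_mul, hd, one_mul]
      exact (norm_apply_le _ _).trans (hχ1 x)
    · push Not at hy
      rw [hval0 y hy, norm_zero]
      exact zero_le_one
  · exact hχ0 x y fun h => hy (mem_iUnion.2 ⟨x, subset_closure h⟩)
  · rw [hval ⟨x, hx⟩ x (by rw [hχx ⟨x, hx⟩]; exact one_ne_zero), hχx ⟨x, hx⟩, mul_one, hdc,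
      mul_comm]

lemma sum_norm_le_norm_finMeasure (b : K →₀ 𝕜) :
    ∑ x ∈ b.support, ‖b x‖ ≤ ‖finMeasure 𝕜 K b‖ := by
  obtain ⟨v, -, hv, -, -, -, hvb⟩ := exists_phase_function b.support isOpen_univ
    (fun _ _ => mem_univ _) b
  have h1 : finMeasure 𝕜 K b v = ((∑ x ∈ b.support, ‖b x‖ : ℝ) : 𝕜) := by
    rw [finMeasure_apply subset_rfl, Finset.sum_congr rfl hvb]
    push_cast; rfl
  have h2 := (finMeasure 𝕜 K b).le_opNorm v
  rw [h1, RCLike.norm_ofReal, abs_of_nonneg (Finset.sum_nonneg fun _ _ => norm_nonneg _)] at h2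
  exact h2.trans (mul_le_of_le_one_right (norm_nonneg _) hv)

lemma exists_finMeasure_norm_sub_le
    (h_scattered : ∀ S : Set K, S.Nonempty → ∃ x ∈ S, ∃ U : Set K, IsOpen U ∧ U ∩ S = {x})
    (f : C₀(K, 𝕜) →L[𝕜] 𝕜) {ε : ℝ} (hε : 0 < ε) :
    ∃ a : K →₀ 𝕜, ‖f - finMeasure 𝕜 K a‖ ≤ ε := by
  obtain ⟨a, ha, hfa⟩ := exists_span_norm_sub_le h_scattered f hε
  rw [Finsupp.mem_span_range_iff_exists_finsupp] at ha
  obtain ⟨b, rfl⟩ := ha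
  exact ⟨b, hfa⟩

/-- A bounded sequence of functions has two arbitrarily late terms that almost agree on a
finite set. -/
lemma exists_lt_sum_norm_sub_le {α : Type*} (a : ℕ → α → 𝕜) {C : ℝ} (ha : ∀ n x, ‖a n x‖ ≤ C)
    (F : Finset α) (M : ℕ) {ε : ℝ} (hε : 0 < ε) :
    ∃ p q, M < p ∧ p < q ∧ ∑ x ∈ F, ‖a p x - a q x‖ ≤ ε := by
  have hC : 0 ≤ C ∨ IsEmpty α := by
    rcases isEmpty_or_nonempty α with h | ⟨⟨x⟩⟩
    · exact Or.inr h
    · exact Or.inl ((norm_nonneg _).trans (ha 0 x))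
  obtain ⟨y, -, φ, hφ, hy⟩ := tendsto_subseq_of_bounded
    (Metric.isBounded_closedBall (x := (0 : F → 𝕜)) (r := |C|))
    (x := fun n (x : F) => a n x) (fun n => by
      rw [mem_closedBall_zero_iff, pi_norm_le_iff_of_nonneg (abs_nonneg C)]
      exact fun x => (ha n x).trans (le_abs_self C))
  obtain ⟨N, hN⟩ := Metric.cauchySeq_iff.1 hy.cauchySeq (ε / (F.card + 1)) (by positivity)
  refine ⟨φ (max N (M + 1)), φ (max N (M + 1) + 1),
    lt_of_lt_of_le (lt_of_lt_of_le M.lt_succ_self (le_max_right N _)) (hφ.id_le _),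
    hφ (Nat.lt_succ_self _), ?_⟩
  have h1 := (hN (max N (M + 1)) (le_max_left _ _) (max N (M + 1) + 1)
    ((le_max_left _ _).trans (Nat.le_succ _))).le
  have h2 : ∀ x ∈ F, ‖a (φ (max N (M + 1))) x - a (φ (max N (M + 1) + 1)) x‖
      ≤ ε / (F.card + 1) := by
    intro x hx
    rw [← dist_eq_norm]
    exact (dist_le_pi_dist (fun x : F => a (φ (max N (M + 1))) x)
      (fun x : F => a (φ (max N (M + 1) + 1)) x) ⟨x, hx⟩).trans h1
  refine (Finset.sum_le_sum h2).trans ?_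
  rw [Finset.sum_const, nsmul_eq_mul, mul_div_assoc', div_le_iff₀ (by positivity)]
  nlinarith

omit [LocallyCompactSpace K] [T2Space K] [TopologicalSpace K] in
lemma norm_half_smul_sub_add_le {E : Type*} [NormedAddCommGroup E] [NormedSpace 𝕜 E]
    (f g h : E →L[𝕜] 𝕜) : ‖(2 : 𝕜)⁻¹ • (f - g) + h‖ ≤ (‖f‖ + ‖g‖) / 2 + ‖h‖ := by
  refine (norm_add_le _ _).trans (add_le_add ?_ le_rfl)
  rw [norm_smul, norm_inv, RCLike.norm_ofNat]
  linarith [norm_sub_le f g]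

/-- Suitable differences of a bounded sequence of functionals on `C₀(K, 𝕜)`, with `K` scattered,
are almost disjointly and finitely supported measures. -/
lemma exists_disjoint_differences
    (h_scattered : ∀ S : Set K, S.Nonempty → ∃ x ∈ S, ∃ U : Set K, IsOpen U ∧ U ∩ S = {x})
    (f : ℕ → C₀(K, 𝕜) →L[𝕜] 𝕜) {C : ℝ} (hf : ∀ n, ‖f n‖ ≤ C) {ε : ℝ} (hε : 0 < ε) :
    ∃ (p q : ℕ → ℕ) (b : ℕ → K →₀ 𝕜), (∀ k, p k < q k) ∧ (∀ j k, j < k → q j < p k) ∧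
      (∀ j k, j ≠ k → Disjoint (b j).support (b k).support) ∧
      ∀ k, ‖(2 : 𝕜)⁻¹ • (f (p k) - f (q k)) - finMeasure 𝕜 K (b k)‖ ≤ ε := by
  classical
  choose a ha using fun n => exists_finMeasure_norm_sub_le h_scattered (f n) (half_pos hε)
  have hab : ∀ n x, ‖a n x‖ ≤ C + ε / 2 := by
    intro n x
    by_cases hx : x ∈ (a n).support
    · have h1 : ‖a n x‖ ≤ ∑ y ∈ (a n).support, ‖a n y‖ :=
        Finset.single_le_sum (f := fun y => ‖a n y‖) (fun _ _ => norm_nonneg _) hx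
      have h2 := sum_norm_le_norm_finMeasure (a n)
      have h3 := norm_le_norm_add_norm_sub (f n) (finMeasure 𝕜 K (a n))
      linarith [ha n, hf n]
    · rw [Finsupp.notMem_support_iff.1 hx, norm_zero]
      linarith [(f n).opNorm_nonneg.trans (hf n)]
  set D : ℕ × ℕ → Finset K := fun z => (a z.1).support ∪ (a z.2).support with hD
  obtain ⟨z, hz, hzr⟩ := exists_seq_of_forall_finset_exists_level (fun z : ℕ × ℕ => z.1 < z.2)
    (fun N y z => y.2 < z.1 ∧ ∑ x ∈ D y, ‖a z.1 x - a z.2 x‖ ≤ (1 / 2) ^ N * ε)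
    (fun N s _ => by
      obtain ⟨p, q, hMp, hpq, hsum⟩ := exists_lt_sum_norm_sub_le (fun n x => a n x) hab
        (s.biUnion D) (s.sup Prod.snd) (ε := (1 / 2) ^ N * ε) (by positivity)
      exact ⟨(p, q), hpq, fun y hy => ⟨(Finset.le_sup (f := Prod.snd) hy).trans_lt hMp,
        (Finset.sum_le_sum_of_subset_of_nonneg (Finset.subset_biUnion_of_mem D hy)
          fun _ _ _ => norm_nonneg _).trans hsum⟩⟩)
    (fun M N y z hNM h => ⟨h.1, h.2.trans (mul_le_mul_of_nonneg_right
      (pow_le_pow_of_le_one (by norm_num) (by norm_num) hNM) hε.le)⟩)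
  set c : ℕ → K →₀ 𝕜 := fun k => (2 : 𝕜)⁻¹ • (a (z k).1 - a (z k).2) with hc
  set B : ℕ → Finset K := fun k => (Finset.range k).biUnion fun j => D (z j) with hB
  have hcD : ∀ k, (c k).support ⊆ D (z k) := fun k =>
    Finsupp.support_smul.trans Finsupp.support_sub
  have hBc : ∀ k, ∑ x ∈ B k, ‖c k x‖ ≤ ε / 2 := by
    intro k
    have h1 : ∀ j ∈ Finset.range k, ∑ x ∈ D (z j), ‖c k x‖ ≤ (1 / 2) * ((1 / 2) ^ k * ε) := by
      intro j hj
      have h2 := (hzr j k (Finset.mem_range.1 hj)).2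
      have h3 : ∀ x, ‖c k x‖ = 1 / 2 * ‖a (z k).1 x - a (z k).2 x‖ := by
        intro x
        simp [hc, norm_mul]
      simp only [h3]
      rw [← Finset.mul_sum]
      exact mul_le_mul_of_nonneg_left h2 (by norm_num)
    have h4 : ∑ x ∈ B k, ‖c k x‖ ≤ ∑ j ∈ Finset.range k, ∑ x ∈ D (z j), ‖c k x‖ :=
      sum_biUnion_le _ _ fun _ => norm_nonneg _
    refine h4.trans ((Finset.sum_le_sum h1).trans ?_)
    rw [Finset.sum_const, Finset.card_range, nsmul_eq_mul]
    have h5 : (k : ℝ) * (1 / 2) ^ k ≤ 1 := by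
      rw [one_div, inv_pow, ← div_eq_mul_inv, div_le_one (by positivity)]
      exact_mod_cast k.lt_two_pow_self.le
    nlinarith
  refine ⟨fun k => (z k).1, fun k => (z k).2, fun k => (c k).filter (· ∉ B k), hz,
    fun j k hjk => (hzr j k hjk).1, ?_, fun k => ?_⟩
  · have hlt : ∀ j k, j < k → Disjoint ((c j).filter (· ∉ B j)).support
        ((c k).filter (· ∉ B k)).support := by
      intro j k hjk
      rw [Finset.disjoint_left]
      intro x hxj hxk
      rw [Finsupp.support_filter, Finset.mem_filter] at hxj hxk
      exact hxk.2 (Finset.mem_biUnion.2 ⟨j, Finset.mem_range.2 hjk, hcD j hxj.1⟩)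
    intro j k hjk
    rcases lt_or_gt_of_ne hjk with h | h
    · exact hlt j k h
    · exact (hlt k j h).symm
  · have h1 : (2 : 𝕜)⁻¹ • (f (z k).1 - f (z k).2) - finMeasure 𝕜 K ((c k).filter (· ∉ B k))
        = (2 : 𝕜)⁻¹ • ((f (z k).1 - finMeasure 𝕜 K (a (z k).1))
          - (f (z k).2 - finMeasure 𝕜 K (a (z k).2)))
          + finMeasure 𝕜 K ((c k).filter (· ∈ B k)) := by
      have h2 : (c k).filter (· ∉ B k) = c k - (c k).filter (· ∈ B k) := by
        rw [eq_sub_iff_add_eq, add_comm]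
        exact Finsupp.filter_add_filter_not _ _
      rw [h2, map_sub, hc, map_smul, map_sub]
      module
    have h3 : ‖finMeasure 𝕜 K ((c k).filter (· ∈ B k))‖ ≤ ε / 2 := by
      refine (norm_finMeasure_le (s := B k) fun x hx => ?_).trans
        ((Finset.sum_le_sum fun x hx => ?_).trans (hBc k))
      · rw [Finsupp.support_filter, Finset.mem_filter] at hx
        exact hx.2
      · rw [Finsupp.filter_apply_pos _ _ hx]
    rw [h1]
    have h4 := norm_half_smul_sub_add_le (f (z k).1 - finMeasure 𝕜 K (a (z k).1))
      (f (z k).2 - finMeasure 𝕜 K (a (z k).2)) (finMeasure 𝕜 K ((c k).filter (· ∈ B k)))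
    linarith [ha (z k).1, ha (z k).2]

end Discrete

section Disjointification

variable {𝕜 : Type*} [RCLike 𝕜] {K : Type*} [TopologicalSpace K]

open Classical in
/-- The total variation of a finitely supported measure on a set. -/
noncomputable def massOn (b : K →₀ 𝕜) (S : Set K) : ℝ := ∑ x ∈ b.support, if x ∈ S then ‖b x‖ else 0

omit [TopologicalSpace K]

lemma massOn_empty (b : K →₀ 𝕜) : massOn b ∅ = 0 := by simp [massOn]

lemma massOn_union_le (b : K →₀ 𝕜) (S S' : Set K) :
    massOn b (S ∪ S') ≤ massOn b S + massOn b S' := by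
  rw [massOn, massOn, massOn, ← Finset.sum_add_distrib]
  refine Finset.sum_le_sum fun x _ => ?_
  by_cases h : x ∈ S <;> by_cases h' : x ∈ S' <;> simp [h, h']

lemma massOn_mono (b : K →₀ 𝕜) {S S' : Set K} (h : S ⊆ S') : massOn b S ≤ massOn b S' := by
  refine Finset.sum_le_sum fun x _ => ?_
  by_cases hx : x ∈ S
  · simp [hx, h hx]
  · rw [if_neg hx]
    split_ifs <;> simp

lemma sum_massOn_le {ι : Type*} [Fintype ι] (b : K →₀ 𝕜) {S : ι → Set K}
    (hS : ∀ i j, i ≠ j → Disjoint (S i) (S j)) : ∑ i, massOn b (S i) ≤ ∑ x ∈ b.support, ‖b x‖ := by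
  classical
  simp only [massOn]
  rw [Finset.sum_comm]
  refine Finset.sum_le_sum fun x _ => ?_
  by_cases hx : ∃ i, x ∈ S i
  · obtain ⟨i, hi⟩ := hx
    rw [Finset.sum_eq_single_of_mem i (Finset.mem_univ _)]
    · simp [hi]
    · intro j _ hj
      exact if_neg fun hxj => disjoint_left.1 (hS j i hj) hxj hi
  · push Not at hx
    rw [Finset.sum_eq_zero fun i _ => if_neg (hx i)]
    exact norm_nonneg _

variable [TopologicalSpace K] [LocallyCompactSpace K] [T2Space K]

omit [LocallyCompactSpace K] in
/-- Pairwise disjoint finite sets in the complement of a closed set have pairwise disjoint open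
neighbourhoods there. -/
lemma exists_disjoint_open {ι : Type*} [Finite ι] (F : ι → Finset K)
    (hF : ∀ i j, i ≠ j → Disjoint (F i) (F j)) {G : Set K} (hG : IsClosed G)
    (hFG : ∀ i, ∀ x ∈ F i, x ∉ G) :
    ∃ O : ι → Set K, (∀ i, IsOpen (O i)) ∧ (∀ i, ∀ x ∈ F i, x ∈ O i) ∧ (∀ i, O i ⊆ Gᶜ) ∧
      ∀ i j, i ≠ j → Disjoint (O i) (O j) := by
  have hfin : (⋃ i, (F i : Set K)).Finite := finite_iUnion fun i => (F i).finite_toSet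
  obtain ⟨U, hU, hUd⟩ := hfin.t2_separation
  refine ⟨fun i => (⋃ x ∈ F i, U x) ∩ Gᶜ, fun i => ?_, fun i x hx => ?_, fun i =>
    inter_subset_right, fun i j hij => ?_⟩
  · exact (isOpen_biUnion fun x _ => (hU x).2).inter hG.isOpen_compl
  · exact ⟨mem_biUnion hx (hU x).1, hFG i x hx⟩
  · rw [disjoint_left]
    rintro y ⟨hy, -⟩ ⟨hy', -⟩
    obtain ⟨x, hx, hyx⟩ := mem_iUnion₂.1 hy
    obtain ⟨x', hx', hyx'⟩ := mem_iUnion₂.1 hy'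
    have hne : x ≠ x' := by
      rintro rfl
      exact Finset.disjoint_left.1 (hF i j hij) hx hx'
    exact disjoint_left.1 (hUd (mem_iUnion.2 ⟨i, hx⟩) (mem_iUnion.2 ⟨j, hx'⟩) hne) hyx hyx'

/-- The inductive step for disjointification: among infinitely many disjointly supported measures
that are small on a closed set `G`, one is almost normed by a function vanishing on `G`, supported
in a closed set on which infinitely many of the other measures are small. -/
lemma exists_disjointification_step {b : ℕ → K →₀ 𝕜}
    (hb : ∀ i j, i ≠ j → Disjoint (b i).support (b j).support) {C : ℝ}
    (hC : ∀ n, ∑ x ∈ (b n).support, ‖b n x‖ ≤ C) {ε η : ℝ} (hη : η < ε) {A : Set ℕ}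
    (hA : A.Infinite) {G : Set K} (hG : IsClosed G) (hAG : ∀ n ∈ A, massOn (b n) G ≤ η) :
    ∃ (i : ℕ) (v : C₀(K, 𝕜)) (A' : Set ℕ) (G' : Set K), i ∈ A ∧ A'.Infinite ∧ A' ⊆ A ∧
      (∀ n ∈ A', i < n) ∧ IsClosed G' ∧ G ⊆ G' ∧ (∃ η' < ε, ∀ n ∈ A', massOn (b n) G' ≤ η') ∧
      ‖v‖ ≤ 1 ∧ (∀ x ∈ G, v x = 0) ∧ (∀ x ∉ G', v x = 0) ∧
      ∑ x ∈ (b i).support, ‖b i x‖ - ε ≤ ‖finMeasure 𝕜 K (b i) v‖ := by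
  classical
  set θ : ℝ := (ε - η) / 2 with hθ
  have hθ0 : 0 < θ := by linarith
  obtain ⟨N, hN⟩ := exists_nat_gt (C / θ)
  have hNC : C < N * θ := by rwa [div_lt_iff₀ hθ0] at hN
  set e : Fin N → ℕ := fun j => hA.natEmbedding A j with he
  have heA : ∀ j, e j ∈ A := fun j => (hA.natEmbedding A j).2
  have heinj : ∀ i j, i ≠ j → e i ≠ e j := fun i j hij h =>
    hij (Fin.ext ((hA.natEmbedding A).injective (Subtype.ext h)))
  set F : Fin N → Finset K := fun j => (b (e j)).support.filter (· ∉ G) with hF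
  obtain ⟨O, hO, hFO, hOG, hOd⟩ := exists_disjoint_open F (fun i j hij =>
    (hb _ _ (heinj i j hij)).mono (Finset.filter_subset _ _) (Finset.filter_subset _ _)) hG
    (fun i x hx => (Finset.mem_filter.1 hx).2)
  have hsmall : ∀ n, ∃ j, massOn (b n) (O j) ≤ θ := by
    intro n
    by_contra hcon
    push Not at hcon
    have h1 := (sum_massOn_le (b n) hOd).trans (hC n)
    have h2 : ∑ _j : Fin N, θ ≤ ∑ j, massOn (b n) (O j) :=
      Finset.sum_le_sum fun j _ => (hcon j).le
    rw [Finset.sum_const, Finset.card_univ, Fintype.card_fin, nsmul_eq_mul] at h2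
    linarith
  obtain ⟨j, hj⟩ : ∃ j, {n | n ∈ A ∧ massOn (b n) (O j) ≤ θ}.Infinite := by
    by_contra hcon
    simp only [not_exists, not_infinite] at hcon
    refine hA ((finite_iUnion hcon).subset fun n hn => ?_)
    obtain ⟨j, hj⟩ := hsmall n
    exact mem_iUnion.2 ⟨j, hn, hj⟩
  obtain ⟨v, G₁, hv, hG₁, hG₁O, hv0, hvF⟩ := exists_phase_function (F j) (hO j) (hFO j) (b (e j))
  have hvG : ∀ x ∈ G, v x = 0 := fun x hx => hv0 x fun h => hOG j (hG₁O h) hx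
  refine ⟨e j, v, {n | n ∈ A ∧ massOn (b n) (O j) ≤ θ} \ Iic (e j), G ∪ G₁, heA j,
    hj.sdiff (finite_Iic _), fun n hn => hn.1.1, fun n hn => not_le.1 hn.2, hG.union hG₁,
    subset_union_left, ⟨η + θ, by linarith, fun n hn => ?_⟩, hv, hvG,
    fun x hx => hv0 x fun h => hx (Or.inr h), ?_⟩
  · exact (massOn_union_le _ _ _).trans
      (add_le_add (hAG n hn.1.1) ((massOn_mono _ hG₁O).trans hn.1.2))
  · have h1 : finMeasure 𝕜 K (b (e j)) v = ((∑ x ∈ F j, ‖b (e j) x‖ : ℝ) : 𝕜) := by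
      rw [finMeasure_apply subset_rfl, RCLike.ofReal_sum, ← Finset.sum_congr rfl hvF, hF,
        Finset.sum_filter]
      refine Finset.sum_congr rfl fun x _ => ?_
      split_ifs with hx
      · rw [hvG x hx, mul_zero]
      · rfl
    have h2 : ∑ x ∈ (b (e j)).support, ‖b (e j) x‖
        = ∑ x ∈ F j, ‖b (e j) x‖ + massOn (b (e j)) G := by
      rw [hF, Finset.sum_filter, massOn, ← Finset.sum_add_distrib]
      refine Finset.sum_congr rfl fun x _ => ?_
      by_cases hx : x ∈ G <;> simp [hx]
    rw [h1, RCLike.norm_ofReal, abs_of_nonneg (Finset.sum_nonneg fun _ _ => norm_nonneg _), h2]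
    linarith [hAG _ (heA j)]

/-- A bounded sequence of disjointly supported finite measures on a locally compact Hausdorff
space is, up to `ε` and a subsequence, normed by the image of the unit vector basis under a
contraction from `c₀`. -/
lemma exists_clm_norming {b : ℕ → K →₀ 𝕜}
    (hb : ∀ i j, i ≠ j → Disjoint (b i).support (b j).support) {C : ℝ}
    (hC : ∀ n, ∑ x ∈ (b n).support, ‖b n x‖ ≤ C) {ε : ℝ} (hε : 0 < ε) {A : Set ℕ}
    (hA : A.Infinite) :
    ∃ (ψ : ℕ → ℕ) (V : C₀(ℕ, 𝕜) →L[𝕜] C₀(K, 𝕜)), StrictMono ψ ∧ (∀ n, ψ n ∈ A) ∧ ‖V‖ ≤ 1 ∧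
      ∀ n, ∑ x ∈ (b (ψ n)).support, ‖b (ψ n) x‖ - ε
        ≤ ‖finMeasure 𝕜 K (b (ψ n)) (V (unitVec 𝕜 n))‖ := by
  let σ : Type _ := {s : Set ℕ × Set K // s.1.Infinite ∧ s.1 ⊆ A ∧ IsClosed s.2 ∧
    ∃ η < ε, ∀ n ∈ s.1, massOn (b n) s.2 ≤ η}
  have hstep : ∀ s : σ, ∃ (i : ℕ) (v : C₀(K, 𝕜)) (s' : σ), i ∈ s.1.1 ∧ s'.1.1 ⊆ s.1.1 ∧
      (∀ n ∈ s'.1.1, i < n) ∧ s.1.2 ⊆ s'.1.2 ∧ ‖v‖ ≤ 1 ∧ (∀ x ∈ s.1.2, v x = 0) ∧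
      (∀ x ∉ s'.1.2, v x = 0) ∧
      ∑ x ∈ (b i).support, ‖b i x‖ - ε ≤ ‖finMeasure 𝕜 K (b i) v‖ := by
    rintro ⟨⟨A₀, G₀⟩, hA₀, hAA, hG₀, η, hη, hsm⟩
    obtain ⟨i, v, A', G', h1, h2, h3, h4, h5, h6, h7, h8, h9, h10, h11⟩ :=
      exists_disjointification_step hb hC hη hA₀ hG₀ hsm
    exact ⟨i, v, ⟨(A', G'), h2, h3.trans hAA, h5, h7⟩, h1, h3, h4, h6, h8, h9, h10, h11⟩
  choose idx v next h1 h2 h3 h4 h5 h6 h7 h8 using hstep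
  let s : ℕ → σ := fun n => Nat.rec
    ⟨(A, ∅), hA, subset_rfl, isClosed_empty, 0, hε, fun n _ => (massOn_empty _).le⟩
    (fun _ t => next t) n
  have hs : ∀ n, s (n + 1) = next (s n) := fun n => rfl
  have hmono : Monotone fun n => (s n).1.2 := monotone_nat_of_le_succ fun n => by
    rw [hs]; exact h4 _
  have hd : ∀ i j, i < j → ∀ x, v (s i) x = 0 ∨ v (s j) x = 0 := by
    intro i j hij x
    by_cases hx : x ∈ (s (i + 1)).1.2
    · exact Or.inr (h6 _ x (hmono (Nat.succ_le_of_lt hij) hx))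
    · exact Or.inl (h7 _ x (by rwa [hs] at hx))
  obtain ⟨V, hV, hVe⟩ := exists_clm_of_disjoint (fun n => v (s n)) (fun n => h5 _)
    (fun i j hij x => by
      rcases lt_or_gt_of_ne hij with h | h
      · exact hd i j h x
      · exact (hd j i h x).symm)
  refine ⟨fun n => idx (s n), V, strictMono_nat_of_lt_succ fun n => ?_,
    fun n => (s n).2.2.1 (h1 _), hV, fun n => ?_⟩
  · exact h3 (s n) _ (by rw [← hs]; exact h1 _)
  · rw [hVe]; exact h8 _

end Disjointification

section Scattered

variable {𝕜 : Type*} [RCLike 𝕜] {K : Type*} [TopologicalSpace K]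
  [LocallyCompactSpace K] [T2Space K]

/-- Bounded functionals that are close to disjointly supported finite measures and whose norms are
bounded below are uniformly nonzero on the image of the unit vector basis under a contraction. -/
lemma exists_clm_le_norm_apply {d : ℕ → C₀(K, 𝕜) →L[𝕜] 𝕜} {b : ℕ → K →₀ 𝕜}
    (hb : ∀ i j, i ≠ j → Disjoint (b i).support (b j).support) {ε C r : ℝ} (hε : 0 < ε)
    (hdb : ∀ k, ‖d k - finMeasure 𝕜 K (b k)‖ ≤ ε) (hC : ∀ k, ‖d k‖ ≤ C) {A : Set ℕ}
    (hA : A.Infinite) (hr : ∀ k ∈ A, r ≤ ‖d k‖) :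
    ∃ (ψ : ℕ → ℕ) (V : C₀(ℕ, 𝕜) →L[𝕜] C₀(K, 𝕜)), StrictMono ψ ∧ ‖V‖ ≤ 1 ∧
      ∀ n, r - 3 * ε ≤ ‖d (ψ n) (V (unitVec 𝕜 n))‖ := by
  have hb1 : ∀ k, ‖finMeasure 𝕜 K (b k)‖ ≤ ‖d k‖ + ε := fun k => by
    have h := norm_le_norm_add_norm_sub (d k) (finMeasure 𝕜 K (b k))
    linarith [hdb k]
  have hb2 : ∀ k, ‖d k‖ ≤ ‖finMeasure 𝕜 K (b k)‖ + ε := fun k => by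
    have h := norm_le_norm_add_norm_sub' (d k) (finMeasure 𝕜 K (b k))
    linarith [hdb k]
  obtain ⟨ψ, V, hψ, hψA, hV, hn⟩ := exists_clm_norming hb (C := C + ε)
    (fun k => (sum_norm_le_norm_finMeasure (b k)).trans
      ((hb1 k).trans (by linarith [hC k]))) hε hA
  refine ⟨ψ, V, hψ, hV, fun n => ?_⟩
  have h1 : ‖V (unitVec 𝕜 n)‖ ≤ 1 :=
    (V.le_of_opNorm_le hV _).trans (by simpa using norm_unitVec_le n)
  have h2 := (d (ψ n) - finMeasure 𝕜 K (b (ψ n))).le_of_opNorm_le (hdb (ψ n)) (V (unitVec 𝕜 n))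
  have h3 : ‖d (ψ n) (V (unitVec 𝕜 n)) - finMeasure 𝕜 K (b (ψ n)) (V (unitVec 𝕜 n))‖ ≤ ε :=
    h2.trans (mul_le_of_le_one_right hε.le h1)
  have h4 := norm_le_norm_add_norm_sub (d (ψ n) (V (unitVec 𝕜 n)))
    (finMeasure 𝕜 K (b (ψ n)) (V (unitVec 𝕜 n)))
  have h5 := norm_finMeasure_le (b := b (ψ n)) subset_rfl
  linarith [hn n, hb2 (ψ n), hr _ (hψA n)]

/-- A pointwise convergent sequence of functionals has interleaved differences that detect fixed
copies of `c₀`. -/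
lemma exists_differences_fixesCopy
    (h_scattered : ∀ S : Set K, S.Nonempty → ∃ x ∈ S, ∃ U : Set K, IsOpen U ∧ U ∩ S = {x})
    {u : ℕ → C₀(K, 𝕜) →L[𝕜] 𝕜} (hu : ∀ n, ‖u n‖ ≤ 1)
    (hconv : ∀ x, ∃ l, Tendsto (fun n => u n x) atTop (𝓝 l))
    (T : C₀(K, 𝕜) →L[𝕜] C₀(K, 𝕜)) {ε : ℝ} (hε : 0 < ε) :
    ∃ p q : ℕ → ℕ, (∀ k, p k < q k) ∧ (∀ j k, j < k → q j < p k) ∧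
      (∀ x, Tendsto (fun k => ((2 : 𝕜)⁻¹ • (u (p k) - u (q k))) x) atTop (𝓝 0)) ∧
      ∀ r, (∃ᶠ k in atTop, r ≤ ‖((2 : 𝕜)⁻¹ • (u (p k) - u (q k))) ∘L T‖) →
        FixesCopy T (r - 3 * ε) := by
  have huT : ∀ n, ‖u n ∘L T‖ ≤ ‖T‖ := fun n =>
    ((u n).opNorm_comp_le T).trans (mul_le_of_le_one_left T.opNorm_nonneg (hu n))
  obtain ⟨p, q, b, hpq, hqp, hb, hd⟩ :=
    exists_disjoint_differences h_scattered (fun n => u n ∘L T) huT hε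
  have hp : StrictMono p := strictMono_nat_of_lt_succ fun k => (hpq k).trans (hqp _ _ k.lt_succ_self)
  have hq : StrictMono q := strictMono_nat_of_lt_succ fun k => (hqp _ _ k.lt_succ_self).trans (hpq _)
  have hnull : ∀ x, Tendsto (fun k => ((2 : 𝕜)⁻¹ • (u (p k) - u (q k))) x) atTop (𝓝 0) := by
    intro x
    obtain ⟨l, hl⟩ := hconv x
    have h := ((hl.comp hp.tendsto_atTop).sub (hl.comp hq.tendsto_atTop)).const_mul (2 : 𝕜)⁻¹
    rw [sub_self, mul_zero] at h
    exact h
  have hhalf : ∀ (f g : C₀(K, 𝕜) →L[𝕜] 𝕜) (C : ℝ), ‖f‖ ≤ C → ‖g‖ ≤ C →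
      ‖(2 : 𝕜)⁻¹ • (f - g)‖ ≤ C := by
    intro f g C hf hg
    have h := norm_half_smul_sub_add_le f g 0
    rw [add_zero, norm_zero] at h
    linarith
  refine ⟨p, q, hpq, hqp, hnull, fun r hr => ?_⟩
  have hcomp : ∀ k, ((2 : 𝕜)⁻¹ • (u (p k) - u (q k))) ∘L T
      = (2 : 𝕜)⁻¹ • (u (p k) ∘L T - u (q k) ∘L T) := fun k => by
    ext x
    rfl
  obtain ⟨ψ, V, hψ, hV, hn⟩ := exists_clm_le_norm_apply hb hε hd
    (fun k => hhalf _ _ _ (huT _) (huT _)) (Nat.frequently_atTop_iff_infinite.1 hr)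
    (fun k hk => (mem_ofPred.1 hk).trans_eq (congrArg _ (hcomp k)))
  exact ⟨fun n => (2 : 𝕜)⁻¹ • (u (p (ψ n)) - u (q (ψ n))), V, fun n => hhalf _ _ _ (hu _) (hu _),
    fun x => (hnull x).comp hψ.tendsto_atTop, hV, (Eventually.of_forall hn).frequently⟩

omit [LocallyCompactSpace K] [T2Space K] in
/-- An operator is compact if its compositions with the evaluations have finite nets. -/
lemma isCompactOperator_of_finite_net {T : C₀(K, 𝕜) →L[𝕜] C₀(K, 𝕜)}
    (h : ∀ δ > 0, ∃ s : Finset K, ∀ x, ∃ y ∈ s, ‖(evalCLM 𝕜 y - evalCLM 𝕜 x) ∘L T‖ < δ) :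
    IsCompactOperator T := by
  refine (isCompactOperator_iff_isCompact_closure_image_closedBall (T : C₀(K, 𝕜) →ₗ[𝕜] C₀(K, 𝕜))
    one_pos).2 ?_
  refine (TotallyBounded.closure ?_).isCompact_of_isClosed isClosed_closure
  refine Metric.totallyBounded_iff.2 fun ε hε => ?_
  obtain ⟨s, hs⟩ := h (ε / 4) (by positivity)
  set Q : C₀(K, 𝕜) →L[𝕜] (s → 𝕜) := ContinuousLinearMap.pi fun y => evalCLM 𝕜 (y : K) ∘L T with hQ
  have hbdd : Bornology.IsBounded (Q '' Metric.closedBall 0 1) :=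
    Q.lipschitz.isBounded_image Metric.isBounded_closedBall
  obtain ⟨t, ht, htf, hcov⟩ := exists_subset_image_finite_and.1
    (Metric.finite_approx_of_totallyBounded
      (hbdd.isCompact_closure.totallyBounded.subset subset_closure) (ε / 4) (by positivity))
  refine ⟨T '' t, htf.image T, ?_⟩
  rintro _ ⟨g, hg, rfl⟩
  obtain ⟨_, ⟨f, hf, rfl⟩, hfg⟩ := mem_iUnion₂.1 (hcov (mem_image_of_mem Q hg))
  refine mem_iUnion₂.2 ⟨T f, mem_image_of_mem T hf, ?_⟩
  have hg1 : ‖g‖ ≤ 1 := mem_closedBall_zero_iff.1 hg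
  have hf1 : ‖f‖ ≤ 1 := mem_closedBall_zero_iff.1 (ht hf)
  change dist (T g) (T f) < ε
  rw [dist_eq_norm]
  refine lt_of_le_of_lt (b := 3 * (ε / 4))
    (norm_le_of_forall (by positivity) fun x => ?_) (by linarith)
  obtain ⟨y, hy, hyx⟩ := hs x
  have h1 : ∀ k : C₀(K, 𝕜), ‖k‖ ≤ 1 → ‖T k y - T k x‖ ≤ ε / 4 := fun k hk => by
    have h2 := ((evalCLM 𝕜 y - evalCLM 𝕜 x) ∘L T).le_of_opNorm_le hyx.le k
    exact h2.trans (mul_le_of_le_one_right (by positivity) hk)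
  have h2 : ‖T g y - T f y‖ ≤ ε / 4 := by
    have h3 := (dist_le_pi_dist (Q g) (Q f) ⟨y, hy⟩).trans (le_of_lt hfg)
    rwa [dist_eq_norm] at h3
  have h3 : (T g - T f) x = -(T g y - T g x) + (T g y - T f y) + (T f y - T f x) := by
    rw [ZeroAtInftyContinuousMap.sub_apply]
    ring
  rw [h3]
  refine (norm_add₃_le).trans ?_
  rw [norm_neg]
  linarith [h1 g hg1, h1 f hf1]

/-- A noncompact operator fixes a copy of `c₀`. -/
lemma exists_fixesCopy_of_not_isCompactOperator
    (h_scattered : ∀ S : Set K, S.Nonempty → ∃ x ∈ S, ∃ U : Set K, IsOpen U ∧ U ∩ S = {x})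
    {T : C₀(K, 𝕜) →L[𝕜] C₀(K, 𝕜)} (hT : ¬ IsCompactOperator T) :
    ∃ δ > 0, FixesCopy T δ := by
  obtain ⟨δ, hδ, hnet⟩ : ∃ δ > 0, ∀ s : Finset K, ∃ x, ∀ y ∈ s,
      δ ≤ ‖(evalCLM 𝕜 y - evalCLM 𝕜 x) ∘L T‖ := by
    by_contra hcon
    push Not at hcon
    exact hT (isCompactOperator_of_finite_net hcon)
  obtain ⟨k, -, hk⟩ := exists_seq_of_forall_finset_exists (fun _ : K => True)
    (fun y x => δ ≤ ‖(evalCLM 𝕜 y - evalCLM 𝕜 x) ∘L T‖)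
    (fun s _ => (hnet s).imp fun x hx => ⟨trivial, hx⟩)
  obtain ⟨φ, hφ, hconv⟩ := exists_subseq_tendsto_apply (𝕜 := 𝕜) h_scattered k
  obtain ⟨p, q, hpq, -, -, hfix⟩ := exists_differences_fixesCopy h_scattered
    (u := fun n => evalCLM 𝕜 (k (φ n))) (fun n => norm_evalCLM_le _) hconv T
    (ε := δ / 12) (by positivity)
  refine ⟨δ / 2 - 3 * (δ / 12), by linarith, hfix _ (Eventually.of_forall fun n => ?_).frequently⟩
  have h1 := hk _ _ (hφ (hpq n))
  have h2 : ‖(evalCLM 𝕜 (k (φ (p n))) - evalCLM 𝕜 (k (φ (q n)))) ∘L T‖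
      ≤ 2 * ‖((2 : 𝕜)⁻¹ • (evalCLM 𝕜 (k (φ (p n))) - evalCLM 𝕜 (k (φ (q n))))) ∘L T‖ := by
    refine ContinuousLinearMap.opNorm_le_bound _ (by positivity) fun x => ?_
    have h3 := (((2 : 𝕜)⁻¹ • (evalCLM 𝕜 (k (φ (p n))) - evalCLM 𝕜 (k (φ (q n))))) ∘L T).le_opNorm x
    have h4 : ‖(((2 : 𝕜)⁻¹ • (evalCLM 𝕜 (k (φ (p n))) - evalCLM 𝕜 (k (φ (q n))))) ∘L T) x‖
        = 2⁻¹ * ‖((evalCLM 𝕜 (k (φ (p n))) - evalCLM 𝕜 (k (φ (q n)))) ∘L T) x‖ := by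
      rw [ContinuousLinearMap.comp_apply, smul_apply, norm_smul, norm_inv, RCLike.norm_ofNat]
      rfl
    rw [h4] at h3
    linarith
  linarith

/-- If a composition fixes a copy of `c₀`, so does one of the factors, with multiplicative
constants. -/
lemma FixesCopy.of_comp
    (h_scattered : ∀ S : Set K, S.Nonempty → ∃ x ∈ S, ∃ U : Set K, IsOpen U ∧ U ∩ S = {x})
    {T₁ T₂ : C₀(K, 𝕜) →L[𝕜] C₀(K, 𝕜)} {δ ε r : ℝ} (h : FixesCopy (T₂ ∘L T₁) δ) (hε : 0 < ε)
    (hr : 0 < r) : FixesCopy T₂ (r - 3 * ε) ∨ FixesCopy T₁ ((δ - ε) / r) := by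
  obtain ⟨u, V, hu, hu0, hV, hdiag, hoff⟩ := h.exists_almost_diagonal
  choose c hc1 hc2 using fun n => RCLike.exists_norm_eq_mul_self (u n ((T₂ ∘L T₁) (V (unitVec 𝕜 n))))
  have hcu : ∀ n x, ‖(c n • u n) x‖ = ‖u n x‖ := fun n x => by
    rw [smul_apply, norm_smul, hc1, one_mul]
  have hcn : ∀ n, ‖c n • u n‖ ≤ 1 := fun n =>
    ContinuousLinearMap.opNorm_le_bound _ zero_le_one fun x => by
      rw [hcu]; exact (u n).le_of_opNorm_le (hu n) x
  have hc0 : ∀ x, Tendsto (fun n => (c n • u n) x) atTop (𝓝 0) := fun x => by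
    rw [tendsto_zero_iff_norm_tendsto_zero]
    simpa only [hcu, norm_zero] using (hu0 x).norm
  obtain ⟨p, q, hpq, hqp, hnull, hfix⟩ :=
    exists_differences_fixesCopy h_scattered hcn (fun x => ⟨0, hc0 x⟩) T₂ hε
  set d : ℕ → C₀(K, 𝕜) →L[𝕜] 𝕜 := fun k =>
    ((2 : 𝕜)⁻¹ • (c (p k) • u (p k) - c (q k) • u (q k))) ∘L T₂ with hd
  by_cases hfr : ∃ᶠ k in atTop, r ≤ ‖d k‖
  · exact Or.inl (hfix r hfr)
  refine Or.inr ?_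
  have hp : StrictMono p := strictMono_nat_of_lt_succ fun k => (hpq k).trans (hqp _ _ k.lt_succ_self)
  have hq : StrictMono q := strictMono_nat_of_lt_succ fun k => (hqp _ _ k.lt_succ_self).trans (hpq _)
  have hdisj : ∀ i j, i < j → ∀ x, (unitVec 𝕜 (p i) - unitVec 𝕜 (q i)) x = 0 ∨
      (unitVec 𝕜 (p j) - unitVec 𝕜 (q j)) x = 0 := by
    intro i j hij x
    have h1 := hpq i
    have h2 := hpq j
    have h3 := hqp i j hij
    rcases le_or_gt x (q i) with hx | hx
    · right
      rw [ZeroAtInftyContinuousMap.sub_apply, unitVec_apply, unitVec_apply, if_neg (by omega),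
        if_neg (by omega), sub_zero]
    · left
      rw [ZeroAtInftyContinuousMap.sub_apply, unitVec_apply, unitVec_apply, if_neg (by omega),
        if_neg (by omega), sub_zero]
  obtain ⟨J, hJ, hJe⟩ := exists_clm_of_disjoint (fun n => unitVec 𝕜 (p n) - unitVec 𝕜 (q n))
    (fun n => norm_le_of_forall zero_le_one fun x => by
      have h1 := (hpq n).ne
      rw [ZeroAtInftyContinuousMap.sub_apply, unitVec_apply, unitVec_apply]
      by_cases hx : x = p n
      · rw [if_pos hx, if_neg (by omega)]; simp
      · rw [if_neg hx]; split_ifs <;> simp)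
    (fun i j hij x => by
      rcases lt_or_gt_of_ne hij with h | h
      · exact hdisj i j h x
      · exact (hdisj j i h x).symm)
  have hev : ∀ᶠ k in atTop, ‖d k‖ < r := by simpa using hfr
  have hpow : ∀ᶠ k in atTop, (1 / 2 : ℝ) ^ q k < ε :=
    ((tendsto_pow_atTop_nhds_zero_of_lt_one (by norm_num) (by norm_num)).comp
      hq.tendsto_atTop).eventually (gt_mem_nhds hε)
  classical
  refine ⟨fun k => if ‖d k‖ < r then ((r : 𝕜)⁻¹) • d k else 0, V ∘L J, fun k => ?_, fun x => ?_,
    ?_, ?_⟩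
  · dsimp only
    split_ifs with hk
    · refine ContinuousLinearMap.opNorm_le_bound _ zero_le_one fun x => ?_
      rw [smul_apply, norm_smul, norm_inv, RCLike.norm_ofReal, abs_of_pos hr, one_mul,
        inv_mul_le_iff₀ hr]
      exact (d k).le_of_opNorm_le hk.le x
    · simp
  · refine Tendsto.congr' (f₁ := fun k => (r : 𝕜)⁻¹ * d k x) ?_ ?_
    · filter_upwards [hev] with k hk
      rw [if_pos hk]
      rfl
    · have h := (hnull (T₂ x)).const_mul (r : 𝕜)⁻¹
      rw [mul_zero] at h
      exact h
  · exact (V.opNorm_comp_le J).trans (mul_le_one₀ hV J.opNorm_nonneg hJ)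
  · refine (hev.and hpow).frequently.mono ?_
    rintro k ⟨hk, hkε⟩
    dsimp only
    rw [if_pos hk, smul_apply, norm_smul, norm_inv, RCLike.norm_ofReal, abs_of_pos hr,
      div_eq_inv_mul]
    refine mul_le_mul_of_nonneg_left ?_ (inv_nonneg.2 hr.le)
    set w : ℕ → ℕ → 𝕜 := fun i j => (c i • u i) ((T₂ ∘L T₁) (V (unitVec 𝕜 j))) with hw
    have hwoff : ∀ i j, i ≠ j → ‖w i j‖ ≤ (1 / 2) ^ max i j := fun i j hij => by
      rw [hw]; dsimp only; rw [hcu]; exact hoff i j hij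
    have hwd : ∀ i, w i i = ((‖u i ((T₂ ∘L T₁) (V (unitVec 𝕜 i)))‖ : ℝ) : 𝕜) := fun i =>
      (hc2 i).symm
    have hdw : d k (T₁ ((V ∘L J) (unitVec 𝕜 k)))
        = 2⁻¹ * ((w (p k) (p k) + w (q k) (q k)) - (w (p k) (q k) + w (q k) (p k))) := by
      have h1 : (V ∘L J) (unitVec 𝕜 k) = V (unitVec 𝕜 (p k)) - V (unitVec 𝕜 (q k)) := by
        rw [ContinuousLinearMap.comp_apply, hJe, map_sub]
      rw [h1]
      simp only [hd, hw, ContinuousLinearMap.comp_apply, smul_apply, sub_apply, map_sub,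
        smul_eq_mul]
      ring
    have h1 : ‖w (p k) (q k) + w (q k) (p k)‖ ≤ 2 * ε := by
      have h2 := hwoff _ _ (hpq k).ne
      have h3 := hwoff _ _ (hpq k).ne'
      rw [max_eq_right (hpq k).le] at h2
      rw [max_eq_left (hpq k).le] at h3
      linarith [norm_add_le (w (p k) (q k)) (w (q k) (p k))]
    have h2 : 2 * δ ≤ ‖w (p k) (p k) + w (q k) (q k)‖ := by
      rw [hwd, hwd, ← RCLike.ofReal_add, RCLike.norm_ofReal]
      exact le_trans (by linarith [hdiag (p k), hdiag (q k)]) (le_abs_self _)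
    have h3 := norm_sub_norm_le (w (p k) (p k) + w (q k) (q k)) (w (p k) (q k) + w (q k) (p k))
    rw [hdw, norm_mul, norm_inv, RCLike.norm_ofNat]
    linarith

end Scattered

lemma opNorm_sub_eq_dist {𝕜 E F : Type*} [RCLike 𝕜] [NormedAddCommGroup E] [NormedSpace 𝕜 E]
    [NormedAddCommGroup F] [NormedSpace 𝕜 F] (S T : E →L[𝕜] F) : ‖S - T‖ = dist S T :=
  (dist_eq_norm S T).symm

section FactorizationSup

variable {𝕜 : Type*} [RCLike 𝕜] {K : Type*} [TopologicalSpace K]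

/-- The function `μ` vanishes on compact operators and is otherwise the supremum of the numbers
`1 / (‖U‖ * ‖V‖)` over all factorizations of the identity of `c₀` through `T` modulo the
compact operators. -/
structure IsFactorizationSup (μ : (C₀(K, 𝕜) →L[𝕜] C₀(K, 𝕜)) → ℝ) : Prop where
  eq_zero : ∀ T : C₀(K, 𝕜) →L[𝕜] C₀(K, 𝕜), IsCompactOperator ⇑T → μ T = 0
  eq_sSup : ∀ T : C₀(K, 𝕜) →L[𝕜] C₀(K, 𝕜), ¬IsCompactOperator ⇑T →
    μ T = sSup {r : ℝ | ∃ (U : C₀(K, 𝕜) →L[𝕜] C₀(ℕ, 𝕜)) (V : C₀(ℕ, 𝕜) →L[𝕜] C₀(K, 𝕜)),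
      IsCompactOperator ⇑(ContinuousLinearMap.id 𝕜 (C₀(ℕ, 𝕜)) - U ∘L T ∘L V) ∧
      r = 1 / (‖U‖ * ‖V‖)}

namespace IsFactorizationSup

variable {μ : (C₀(K, 𝕜) →L[𝕜] C₀(K, 𝕜)) → ℝ} {T T₁ T₂ : C₀(K, 𝕜) →L[𝕜] C₀(K, 𝕜)} {δ : ℝ}

lemma nonneg (h : IsFactorizationSup μ) (T : C₀(K, 𝕜) →L[𝕜] C₀(K, 𝕜)) : 0 ≤ μ T := by
  by_cases hT : IsCompactOperator T
  · exact (h.eq_zero T hT).ge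
  · rw [h.eq_sSup T hT]
    refine Real.sSup_nonneg ?_
    rintro _ ⟨U, V, -, rfl⟩
    exact one_div_nonneg.2 (mul_nonneg U.opNorm_nonneg V.opNorm_nonneg)

lemma le_of_fixesCopy (h : IsFactorizationSup μ) (hT : FixesCopy T δ) : δ ≤ μ T := by
  rcases le_or_gt δ 0 with hδ | hδ
  · exact hδ.trans (h.nonneg T)
  have hTc : ¬ IsCompactOperator T := fun hc => hδ.not_ge (hT.le_zero_of_isCompactOperator hc)
  obtain ⟨U, V, hUV, hle⟩ := hT.exists_factorization hδ
  rw [h.eq_sSup T hTc]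
  refine hle.trans (le_csSup ⟨‖T‖, ?_⟩ ⟨U, V, hUV, rfl⟩)
  rintro _ ⟨U, V, hUV, rfl⟩
  exact le_of_forall_lt_imp_le_of_dense fun c hc => (fixesCopy_of_isCompactOperator hUV hc).le_norm

lemma fixesCopy_of_lt (h : IsFactorizationSup μ) (h0 : 0 ≤ δ) (hδ : δ < μ T) : FixesCopy T δ := by
  have hTc : ¬ IsCompactOperator T := fun hc => by
    rw [h.eq_zero T hc] at hδ
    exact h0.not_gt hδ
  rw [h.eq_sSup T hTc] at hδ
  by_cases hne : {r : ℝ | ∃ (U : C₀(K, 𝕜) →L[𝕜] C₀(ℕ, 𝕜)) (V : C₀(ℕ, 𝕜) →L[𝕜] C₀(K, 𝕜)),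
      IsCompactOperator ⇑(ContinuousLinearMap.id 𝕜 (C₀(ℕ, 𝕜)) - U ∘L T ∘L V) ∧
      r = 1 / (‖U‖ * ‖V‖)}.Nonempty
  · obtain ⟨_, ⟨U, V, hUV, rfl⟩, hlt⟩ := exists_lt_of_lt_csSup hne hδ
    exact fixesCopy_of_isCompactOperator hUV hlt
  · rw [not_nonempty_iff_eq_empty.1 hne, Real.sSup_empty] at hδ
    exact absurd hδ h0.not_gt

lemma le_norm (h : IsFactorizationSup μ) (T : C₀(K, 𝕜) →L[𝕜] C₀(K, 𝕜)) : μ T ≤ ‖T‖ := by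
  refine le_of_forall_lt_imp_le_of_dense fun δ hδ => ?_
  rcases lt_or_ge δ 0 with h0 | h0
  · exact h0.le.trans T.opNorm_nonneg
  · exact (h.fixesCopy_of_lt h0 hδ).le_norm

lemma add_le (h : IsFactorizationSup μ) (T₁ T₂ : C₀(K, 𝕜) →L[𝕜] C₀(K, 𝕜)) :
    μ (T₁ + T₂) ≤ μ T₁ + μ T₂ := by
  by_contra! hlt
  set η : ℝ := (μ (T₁ + T₂) - (μ T₁ + μ T₂)) / 3 with hη
  have hη0 : 0 < η := by linarith
  have h1 := h.nonneg T₁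
  have h2 := h.nonneg T₂
  rcases (h.fixesCopy_of_lt (T := T₁ + T₂) (δ := (μ T₁ + η) + (μ T₂ + η)) (by linarith)
    (by linarith)).of_add with h3 | h3
  · linarith [h.le_of_fixesCopy h3]
  · linarith [h.le_of_fixesCopy h3]

lemma le_of_isCompactOperator_sub (h : IsFactorizationSup μ)
    (hT : IsCompactOperator ⇑(T₁ - T₂)) : μ T₁ ≤ μ T₂ := by
  have h1 := h.add_le (T₁ - T₂) T₂
  have h2 : T₁ - T₂ + T₂ = T₁ := ContinuousLinearMap.ext fun x => sub_add_cancel (T₁ x) (T₂ x)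
  rwa [h2, h.eq_zero _ hT, zero_add] at h1

lemma eq_of_isCompactOperator_sub (h : IsFactorizationSup μ)
    (hT : IsCompactOperator ⇑(T₁ - T₂)) : μ T₁ = μ T₂ := by
  refine le_antisymm (h.le_of_isCompactOperator_sub hT) (h.le_of_isCompactOperator_sub ?_)
  have h1 : (T₂ - T₁ : C₀(K, 𝕜) → C₀(K, 𝕜)) = -⇑(T₁ - T₂) :=
    funext fun x => (neg_sub (T₁ x) (T₂ x)).symm
  have h2 := hT.neg
  rw [← h1] at h2
  exact h2

lemma le_infDist (h : IsFactorizationSup μ) (T : C₀(K, 𝕜) →L[𝕜] C₀(K, 𝕜)) :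
    μ T ≤ Metric.infDist T {S : C₀(K, 𝕜) →L[𝕜] C₀(K, 𝕜) | IsCompactOperator ⇑S} := by
  refine (Metric.le_infDist ⟨0, isCompactOperator_zero⟩).2 fun S hS => ?_
  have h1 : T - (T - S) = S := ContinuousLinearMap.ext fun x => sub_sub_cancel (T x) (S x)
  refine ((h.le_of_isCompactOperator_sub (T₂ := T - S) ?_).trans (h.le_norm _)).trans_eq
    (opNorm_sub_eq_dist T S)
  rw [h1]
  exact hS

lemma norm_mul_le_smul (h : IsFactorizationSup μ) (c : 𝕜) (T : C₀(K, 𝕜) →L[𝕜] C₀(K, 𝕜)) :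
    ‖c‖ * μ T ≤ μ (c • T) := by
  refine le_of_forall_lt_imp_le_of_dense fun δ hδ => ?_
  rcases lt_or_ge δ 0 with h0 | h0
  · exact h0.le.trans (h.nonneg _)
  have hc : 0 < ‖c‖ := by
    by_contra! hc
    exact (h0.trans_lt hδ).not_ge (mul_nonpos_of_nonpos_of_nonneg hc (h.nonneg T))
  have h1 := (h.fixesCopy_of_lt (div_nonneg h0 hc.le) ((div_lt_iff₀' hc).2 hδ)).smul c
  rw [mul_div_cancel₀ _ hc.ne'] at h1
  exact h.le_of_fixesCopy h1

lemma smul (h : IsFactorizationSup μ) (c : 𝕜) (T : C₀(K, 𝕜) →L[𝕜] C₀(K, 𝕜)) :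
    μ (c • T) = ‖c‖ * μ T := by
  refine le_antisymm ?_ (h.norm_mul_le_smul c T)
  by_cases hc : c = 0
  · have h1 : c • T = 0 := ContinuousLinearMap.ext fun x => by
      rw [hc]
      exact zero_smul 𝕜 (T x)
    rw [h1, hc, norm_zero, zero_mul, h.eq_zero _ isCompactOperator_zero]
  · have h1 := h.norm_mul_le_smul c⁻¹ (c • T)
    have h2 : c⁻¹ • c • T = T := ContinuousLinearMap.ext fun x => inv_smul_smul₀ hc (T x)
    rwa [h2, norm_inv, inv_mul_le_iff₀ (norm_pos_iff.2 hc)] at h1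

variable [LocallyCompactSpace K] [T2Space K]

lemma comp_le (h : IsFactorizationSup μ)
    (h_scattered : ∀ S : Set K, S.Nonempty → ∃ x ∈ S, ∃ U : Set K, IsOpen U ∧ U ∩ S = {x})
    (T₁ T₂ : C₀(K, 𝕜) →L[𝕜] C₀(K, 𝕜)) : μ (T₂ ∘L T₁) ≤ μ T₂ * μ T₁ := by
  have h1 := h.nonneg T₁
  have h2 := h.nonneg T₂
  refine le_of_forall_lt_imp_le_of_dense fun δ hδ => ?_
  rcases lt_or_ge δ 0 with h0 | h0
  · exact h0.le.trans (mul_nonneg h2 h1)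
  have key : ∀ ε > 0, δ ≤ (μ T₂ + 4 * ε) * μ T₁ + ε := by
    intro ε hε
    have hr : 0 < μ T₂ + 4 * ε := by linarith
    rcases (h.fixesCopy_of_lt h0 hδ).of_comp h_scattered hε hr with h3 | h3
    · linarith [h.le_of_fixesCopy h3]
    · have h4 := (div_le_iff₀' hr).1 (h.le_of_fixesCopy h3)
      linarith
  have hlim : Tendsto (fun ε : ℝ => (μ T₂ + 4 * ε) * μ T₁ + ε) (𝓝[>] 0)
      (𝓝 ((μ T₂ + 4 * 0) * μ T₁ + 0)) :=
    (Continuous.tendsto (by fun_prop) 0).mono_left nhdsWithin_le_nhds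
  rw [mul_zero, add_zero, add_zero] at hlim
  exact ge_of_tendsto hlim (eventually_mem_nhdsWithin.mono key)

end IsFactorizationSup

end FactorizationSup

end ZeroAtInftyCalkin

/-- Let `K` be a scattered, locally compact Hausdorff space and define
`μ(T) = 0` for compact `T` and otherwise
`μ(T) = sup { 1/(‖U‖·‖V‖) : I_{c₀} − U∘T∘V is compact }`. Then μ vanishes only described
above, is dominated by the essential norm, is invariant under compact perturbations,
absolutely homogeneous, subadditive and submultiplicative; in particular it induces an
algebra norm on the Calkin algebra of `C₀(K)` dominated by the essential norm. -/
theorem statement19 {𝕜 : Type*} [RCLike 𝕜] {K : Type*} [TopologicalSpace K]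
    [LocallyCompactSpace K] [T2Space K]
    (h_scattered : ∀ S : Set K, S.Nonempty → ∃ x ∈ S, ∃ U : Set K, IsOpen U ∧ U ∩ S = {x})
    (μ : (C₀(K, 𝕜) →L[𝕜] C₀(K, 𝕜)) → ℝ)
    (hμ_compact : ∀ T : C₀(K, 𝕜) →L[𝕜] C₀(K, 𝕜), IsCompactOperator ⇑T → μ T = 0)
    (hμ_def : ∀ T : C₀(K, 𝕜) →L[𝕜] C₀(K, 𝕜), ¬IsCompactOperator ⇑T →
      μ T = sSup {r : ℝ | ∃ (U : C₀(K, 𝕜) →L[𝕜] C₀(ℕ, 𝕜)) (V : C₀(ℕ, 𝕜) →L[𝕜] C₀(K, 𝕜)),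
        IsCompactOperator ⇑(ContinuousLinearMap.id 𝕜 (C₀(ℕ, 𝕜)) - U ∘L T ∘L V) ∧
        r = 1 / (‖U‖ * ‖V‖)}) :
    (∀ T : C₀(K, 𝕜) →L[𝕜] C₀(K, 𝕜), ¬IsCompactOperator ⇑T →
      {r : ℝ | ∃ (U : C₀(K, 𝕜) →L[𝕜] C₀(ℕ, 𝕜)) (V : C₀(ℕ, 𝕜) →L[𝕜] C₀(K, 𝕜)),
        IsCompactOperator ⇑(ContinuousLinearMap.id 𝕜 (C₀(ℕ, 𝕜)) - U ∘L T ∘L V) ∧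
        r = 1 / (‖U‖ * ‖V‖)}.Nonempty ∧ 0 < μ T) ∧
    (∀ T : C₀(K, 𝕜) →L[𝕜] C₀(K, 𝕜),
      μ T ≤ Metric.infDist T
        {S : C₀(K, 𝕜) →L[𝕜] C₀(K, 𝕜) | IsCompactOperator ⇑S}) ∧
    (∀ T T' : C₀(K, 𝕜) →L[𝕜] C₀(K, 𝕜), IsCompactOperator ⇑(T - T') → μ T = μ T') ∧
    (∀ (c : 𝕜) (T : C₀(K, 𝕜) →L[𝕜] C₀(K, 𝕜)), μ (c • T) = ‖c‖ * μ T) ∧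
    (∀ T₁ T₂ : C₀(K, 𝕜) →L[𝕜] C₀(K, 𝕜), μ (T₁ + T₂) ≤ μ T₁ + μ T₂) ∧
    (∀ T₁ T₂ : C₀(K, 𝕜) →L[𝕜] C₀(K, 𝕜), μ (T₂ ∘L T₁) ≤ μ T₂ * μ T₁) := by
  have h : ZeroAtInftyCalkin.IsFactorizationSup μ := ⟨hμ_compact, hμ_def⟩
  refine ⟨fun T hT => ?_, h.le_infDist, fun _ _ hT => h.eq_of_isCompactOperator_sub hT, h.smul,
    h.add_le, h.comp_le h_scattered⟩
  obtain ⟨δ, hδ, hfix⟩ :=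
    ZeroAtInftyCalkin.exists_fixesCopy_of_not_isCompactOperator h_scattered hT
  obtain ⟨U, V, hUV, -⟩ := hfix.exists_factorization hδ
  exact ⟨⟨_, U, V, hUV, rfl⟩, hδ.trans_le (h.le_of_fixesCopy hfix)⟩
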